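/- Σ_{n=0}^∞ (−1)^n (2n+1)^9 / cosh((2n+1)π/2)^3 = 189Γ^20/(2^13 π^15) − 297Γ^20/(2^12 π^16), where Γ = Γ(1/4). -/

import Mathlib

open Real
open Filter Topology
open Complex (I)

local notation "cexp" => Complex.exp

/-- A sequence indexed by `ℤ` that is summable against every power of the index. -/
def RapidDecay (a : ℤ → ℝ) : Prop := ∀ k : ℕ, Summable fun n : ℤ => |(n : ℝ)| ^ k * |a n|

theorem rapidDecay_exp_neg_abs {c : ℝ} (hc : 0 < c) :
    RapidDecay fun n : ℤ => Real.exp (-c * |(n : ℝ)|) := by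
  intro k
  have h := Real.summable_pow_mul_exp_neg_nat_mul k hc
  apply Summable.of_nat_of_neg <;> refine h.congr fun n => ?_ <;> simp

namespace RapidDecay

variable {a b : ℤ → ℝ}

theorem summable_abs (ha : RapidDecay a) : Summable fun n => |a n| := by
  simpa using ha 0

theorem summable (ha : RapidDecay a) : Summable a := ha.summable_abs.of_abs

theorem of_abs_le (ha : RapidDecay a) (C : ℝ) (h : ∀ n, |b n| ≤ C * |a n|) : RapidDecay b := by
  intro k
  refine Summable.of_nonneg_of_le (fun n => by positivity) (fun n => ?_) ((ha k).mul_left C)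
  calc |(n : ℝ)| ^ k * |b n| ≤ |(n : ℝ)| ^ k * (C * |a n|) := by gcongr; exact h n
    _ = C * (|(n : ℝ)| ^ k * |a n|) := by ring

theorem const_mul (ha : RapidDecay a) (C : ℝ) : RapidDecay fun n => C * a n :=
  ha.of_abs_le |C| fun _ => (abs_mul _ _).le

theorem mul_of_abs_le (ha : RapidDecay a) {C : ℝ} (h : ∀ n, |b n| ≤ C) :
    RapidDecay fun n => a n * b n :=
  ha.of_abs_le C fun n => by
    rw [abs_mul, mul_comm]
    gcongr
    exact h n

theorem add (ha : RapidDecay a) (hb : RapidDecay b) : RapidDecay fun n => a n + b n := by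
  intro k
  refine Summable.of_nonneg_of_le (fun n => by positivity) (fun n => ?_) ((ha k).add (hb k))
  rw [← mul_add]
  gcongr
  exact abs_add_le _ _

theorem index_mul (ha : RapidDecay a) : RapidDecay fun n => (n : ℝ) * a n := fun k =>
  (ha (k + 1)).congr fun n => by rw [abs_mul]; ring

theorem affine_mul (ha : RapidDecay a) (c d : ℝ) : RapidDecay fun n => (c * n + d) * a n := by
  have h := (ha.index_mul.const_mul c).add (ha.const_mul d)
  convert h using 2
  ring

theorem affine_pow_mul (ha : RapidDecay a) (c d : ℝ) (k : ℕ) :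
    RapidDecay fun n => (c * n + d) ^ k * a n := by
  induction k with
  | zero => simpa using ha
  | succ k ih =>
    have h := ih.affine_mul c d
    convert h using 2
    ring

end RapidDecay

/-- The hyperbolic secant at the half-odd multiples of `y`. -/
noncomputable def oddSech (y : ℝ) (n : ℤ) : ℝ := (Real.cosh ((2 * n + 1) * y / 2))⁻¹

/-- The hyperbolic tangent at the half-odd multiples of `y`. -/
noncomputable def oddTanh (y : ℝ) (n : ℤ) : ℝ := Real.sinh ((2 * n + 1) * y / 2) * oddSech y n

/-- The hyperbolic cosecant at the multiples of `y`, with value `0` at `0`. -/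
noncomputable def evenCsch (y : ℝ) (j : ℤ) : ℝ := (Real.sinh (j * y))⁻¹

theorem oddSech_pos (y : ℝ) (n : ℤ) : 0 < oddSech y n := inv_pos.2 (Real.cosh_pos _)

theorem oddSech_le_one (y : ℝ) (n : ℤ) : oddSech y n ≤ 1 :=
  inv_le_one_of_one_le₀ (Real.one_le_cosh _)

theorem abs_oddSech_le_one (y : ℝ) (n : ℤ) : |oddSech y n| ≤ 1 := by
  rw [abs_of_pos (oddSech_pos y n)]; exact oddSech_le_one y n

theorem oddSech_neg (y : ℝ) (n : ℤ) : oddSech y (-1 - n) = oddSech y n := by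
  unfold oddSech
  rw [← Real.cosh_neg]
  push_cast
  ring_nf

theorem oddTanh_neg (y : ℝ) (n : ℤ) : oddTanh y (-1 - n) = -oddTanh y n := by
  unfold oddTanh
  rw [oddSech_neg, ← neg_mul, ← Real.sinh_neg]
  push_cast
  ring_nf

theorem abs_oddTanh_le_one (y : ℝ) (n : ℤ) : |oddTanh y n| ≤ 1 := by
  unfold oddTanh oddSech
  rw [← div_eq_mul_inv, abs_div, abs_of_pos (Real.cosh_pos _), div_le_one (Real.cosh_pos _),
    Real.abs_sinh, ← Real.cosh_abs]
  exact (Real.sinh_lt_cosh _).le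

theorem evenCsch_zero (y : ℝ) : evenCsch y 0 = 0 := by simp [evenCsch]

theorem evenCsch_neg (y : ℝ) (j : ℤ) : evenCsch y (-j) = -evenCsch y j := by
  simp [evenCsch, Real.sinh_neg, inv_neg]

theorem sinh_mul_evenCsch {y : ℝ} (hy : 0 < y) {j : ℤ} (hj : j ≠ 0) :
    Real.sinh (j * y) * evenCsch y j = 1 :=
  mul_inv_cancel₀ (by simp [hj, hy.ne'])

theorem inv_cosh_le (x : ℝ) : (Real.cosh x)⁻¹ ≤ 2 * Real.exp (-|x|) := by
  rw [Real.exp_neg, ← Real.cosh_abs, ← div_eq_mul_inv, inv_eq_one_div,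
    div_le_div_iff₀ (Real.cosh_pos _) (Real.exp_pos _), Real.cosh_eq]
  linarith [Real.exp_pos (-|x|)]

theorem rapidDecay_oddSech {y : ℝ} (hy : 0 < y) : RapidDecay (oddSech y) := by
  refine (rapidDecay_exp_neg_abs hy).of_abs_le (2 * Real.exp (y / 2)) fun n => ?_
  rw [abs_of_pos (oddSech_pos y n), abs_of_pos (Real.exp_pos _)]
  refine (inv_cosh_le _).trans ?_
  rw [mul_assoc, ← Real.exp_add]
  gcongr
  rw [abs_div, abs_mul, abs_of_pos hy, abs_two]
  have h : 2 * |(n : ℝ)| - 1 ≤ |2 * (n : ℝ) + 1| := by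
    have := abs_sub_abs_le_abs_sub (2 * (n : ℝ)) (-1)
    simpa [abs_mul] using this
  nlinarith

theorem rapidDecay_evenCsch {y : ℝ} (hy : 0 < y) : RapidDecay (evenCsch y) := by
  have h1 : 0 < 1 - Real.exp (-2 * y) := by
    rw [sub_pos, Real.exp_lt_one_iff]; linarith
  refine (rapidDecay_exp_neg_abs hy).of_abs_le (2 / (1 - Real.exp (-2 * y))) fun j => ?_
  rw [abs_of_pos (Real.exp_pos _)]
  rcases eq_or_ne j 0 with rfl | hj
  · rw [evenCsch_zero, abs_zero]; positivity
  have hj1 : (1 : ℝ) ≤ |(j : ℝ)| := by exact_mod_cast Int.one_le_abs hj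
  rw [evenCsch, abs_inv, Real.abs_sinh, abs_mul, abs_of_pos hy, div_mul_eq_mul_div,
    inv_eq_one_div, div_le_div_iff₀ (Real.sinh_pos_iff.2 (by positivity)) h1, Real.sinh_eq]
  have h2 : Real.exp (-2 * y) ≥ Real.exp (-y * |(j : ℝ)|) * Real.exp (-(|(j : ℝ)| * y)) := by
    rw [← Real.exp_add]
    apply Real.exp_le_exp.2
    nlinarith
  have h3 : Real.exp (-y * |(j : ℝ)|) * Real.exp (|(j : ℝ)| * y) = 1 := by
    rw [← Real.exp_add]; simp [mul_comm]
  nlinarith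

theorem tendsto_tanh_atTop : Tendsto (fun x : ℝ => Real.sinh x * (Real.cosh x)⁻¹) atTop (𝓝 1) := by
  have h : Tendsto (fun x : ℝ => Real.exp (-x) * (Real.cosh x)⁻¹) atTop (𝓝 0) := by
    refine squeeze_zero (fun x => by have := Real.cosh_pos x; positivity) (fun x => ?_)
      (Real.tendsto_exp_neg_atTop_nhds_zero)
    exact mul_le_of_le_one_right (Real.exp_pos _).le (inv_le_one_of_one_le₀ (Real.one_le_cosh x))
  have h2 := (tendsto_const_nhds (x := (1 : ℝ))).sub h
  rw [sub_zero] at h2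
  refine h2.congr fun x => ?_
  have h3 := Real.cosh_sub_sinh x
  have := (Real.cosh_pos x).ne'
  field_simp
  linarith

theorem tendsto_oddTanh_atTop {y : ℝ} (hy : 0 < y) :
    Tendsto (fun n : ℤ => oddTanh y n) atTop (𝓝 1) := by
  refine tendsto_tanh_atTop.comp ?_
  refine Tendsto.atTop_div_const two_pos (Tendsto.atTop_mul_const hy ?_)
  exact tendsto_atTop_add_const_right _ _
    (tendsto_intCast_atTop_atTop.const_mul_atTop two_pos)

/-- Telescoping over `ℤ`. -/
theorem tsum_int_succ_sub {g : ℤ → ℝ} {l l' : ℝ} (hg : Summable fun n => g (n + 1) - g n)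
    (hl : Tendsto g atTop (𝓝 l)) (hl' : Tendsto g atBot (𝓝 l')) :
    ∑' n, (g (n + 1) - g n) = l - l' := by
  have h1 : HasSum (fun n : ℕ => g ((n : ℤ) + 1) - g n) (l - g 0) := by
    have hs : Summable fun n : ℕ => g ((n : ℤ) + 1) - g n :=
      hg.comp_injective (i := fun n : ℕ => (n : ℤ)) Nat.cast_injective
    refine (hs.hasSum_iff_tendsto_nat).2 ?_
    have := Finset.sum_range_sub (fun n : ℕ => g n)
    push_cast at this
    simp_rw [this]
    exact (hl.comp tendsto_natCast_atTop_atTop).sub_const _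
  have h2 : HasSum (fun n : ℕ => g (-((n : ℤ) + 1) + 1) - g (-((n : ℤ) + 1))) (g 0 - l') := by
    have hs : Summable fun n : ℕ => g (-((n : ℤ) + 1) + 1) - g (-((n : ℤ) + 1)) :=
      hg.comp_injective (i := fun n : ℕ => -((n : ℤ) + 1)) fun a b h => by simpa using h
    refine (hs.hasSum_iff_tendsto_nat).2 ?_
    have := Finset.sum_range_sub' (fun n : ℕ => g (-(n : ℤ)))
    push_cast at this
    have e : ∀ n : ℕ, -((n : ℤ) + 1) + 1 = -n := fun n => by ring
    simp_rw [e, this]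
    simp only [neg_zero]
    exact (hl'.comp (tendsto_neg_atTop_atBot.comp tendsto_natCast_atTop_atTop)).const_sub _
  refine (HasSum.of_nat_of_neg_add_one (f := fun n => g (n + 1) - g n) h1 h2).tsum_eq.trans ?_
  ring

theorem tendsto_oddTanh_atBot {y : ℝ} (hy : 0 < y) :
    Tendsto (fun n : ℤ => oddTanh y n) atBot (𝓝 (-1)) := by
  have h := ((tendsto_oddTanh_atTop hy).comp
    (tendsto_atTop_add_const_left atBot (-1 : ℤ) tendsto_neg_atBot_atTop)).neg
  refine h.congr fun n => ?_
  rw [Function.comp, ← oddTanh_neg]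
  congr 1
  ring

/-- The product formula behind every convolution identity of hyperbolic secants. -/
theorem oddTanh_sub (y : ℝ) (m n : ℤ) :
    oddTanh y m - oddTanh y n = Real.sinh (((m - n : ℤ) : ℝ) * y) * (oddSech y m * oddSech y n) := by
  have e : ((m - n : ℤ) : ℝ) * y = (2 * m + 1) * y / 2 - (2 * n + 1) * y / 2 := by push_cast; ring
  rw [e, Real.sinh_sub]
  unfold oddTanh oddSech
  have h1 := (Real.cosh_pos ((2 * m + 1) * y / 2)).ne'
  have h2 := (Real.cosh_pos ((2 * n + 1) * y / 2)).ne'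
  field_simp

theorem summable_oddTanh_succ_sub {y : ℝ} (hy : 0 < y) :
    RapidDecay fun n => oddTanh y (n + 1) - oddTanh y n := by
  have h := ((rapidDecay_oddSech hy).mul_of_abs_le (b := fun n => oddSech y (n + 1))
    fun n => abs_oddSech_le_one y _).const_mul (Real.sinh y)
  convert h using 2 with n
  rw [oddTanh_sub]
  simp [mul_comm]

theorem tsum_oddTanh_succ_sub {y : ℝ} (hy : 0 < y) :
    ∑' n, (oddTanh y (n + 1) - oddTanh y n) = 2 := by
  rw [tsum_int_succ_sub (summable_oddTanh_succ_sub hy).summable (tendsto_oddTanh_atTop hy)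
    (tendsto_oddTanh_atBot hy)]
  norm_num

theorem tsum_oddTanh_sub {y : ℝ} (hy : 0 < y) (j : ℤ) :
    ∑' n, (oddTanh y n - oddTanh y (n - j)) = 2 * j := by
  have hs : ∀ j : ℤ, Summable fun n => oddTanh y n - oddTanh y (n - j) := fun j => by
    have h := ((rapidDecay_oddSech hy).mul_of_abs_le (b := fun n => oddSech y (n - j))
      fun n => abs_oddSech_le_one y _).const_mul (Real.sinh (j * y))
    refine h.summable.congr fun n => ?_
    rw [oddTanh_sub]
    simp
  have hstep : ∀ j : ℤ, ∑' n, (oddTanh y n - oddTanh y (n - (j + 1))) =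
      ∑' n, (oddTanh y n - oddTanh y (n - j)) + 2 := fun j => by
    have h2 : ∑' n, (oddTanh y (n - j) - oddTanh y (n - (j + 1))) = 2 := by
      rw [← tsum_oddTanh_succ_sub hy, ← (Equiv.subRight (j + 1)).tsum_eq
        fun n => oddTanh y (n + 1) - oddTanh y n]
      refine tsum_congr fun n => ?_
      simp only [Equiv.subRight_apply]
      congr 2
      ring
    have hs2 : Summable fun n => oddTanh y (n - j) - oddTanh y (n - (j + 1)) :=
      ((hs (j + 1)).sub (hs j)).congr fun n => by ring
    rw [← h2, ← (hs j).tsum_add hs2]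
    exact tsum_congr fun n => by ring
  induction j using Int.induction_on with
  | zero => simp
  | succ i ih => rw [hstep, ih]; push_cast; ring
  | pred i ih =>
    have h := hstep (-i - 1)
    rw [sub_add_cancel, ih] at h
    push_cast at h ⊢
    linarith

theorem tsum_oddSech_mul_oddSech {y : ℝ} (hy : 0 < y) {j : ℤ} (hj : j ≠ 0) :
    ∑' n, oddSech y n * oddSech y (j - 1 - n) = 2 * j * evenCsch y j := by
  rw [← tsum_oddTanh_sub hy j, ← tsum_mul_right]
  refine tsum_congr fun n => ?_
  rw [oddTanh_sub, ← oddSech_neg y (j - 1 - n), show (-1 - (j - 1 - n)) = n - j by ring,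
    sub_sub_cancel, mul_right_comm, sinh_mul_evenCsch hy hj, one_mul]

/-- The kernel `cosh (A + B) / (sinh A * cosh B) = coth A + tanh B` at `A = j y` and
`A + B = (2 p + 1) y / 2`. -/
noncomputable def cothTanh (y : ℝ) (p j : ℤ) : ℝ :=
  Real.cosh ((2 * p + 1) * y / 2) * (evenCsch y j * oddSech y (p - j))

theorem cothTanh_eq {y : ℝ} (hy : 0 < y) (p : ℤ) {j : ℤ} (hj : j ≠ 0) :
    cothTanh y p j = Real.cosh (j * y) * evenCsch y j + oddTanh y (p - j) := by
  have e : (2 * (p : ℝ) + 1) * y / 2 = j * y + (2 * ((p - j : ℤ) : ℝ) + 1) * y / 2 := by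
    push_cast; ring
  have h1 : Real.sinh (j * y) ≠ 0 := by simp [hj, hy.ne']
  rw [cothTanh, e, Real.cosh_add]
  unfold oddTanh oddSech evenCsch
  have h2 := (Real.cosh_pos ((2 * ((p - j : ℤ) : ℝ) + 1) * y / 2)).ne'
  field_simp

theorem oddSech_mul_cothTanh (y : ℝ) (p j : ℤ) :
    oddSech y p * cothTanh y p j = evenCsch y j * oddSech y (p - j) := by
  rw [cothTanh, ← mul_assoc, oddSech, inv_mul_cancel₀ (Real.cosh_pos _).ne', one_mul]

theorem cothTanh_zero (y : ℝ) (p : ℤ) : cothTanh y p 0 = 0 := by simp [cothTanh, evenCsch_zero]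

theorem cothTanh_neg (y : ℝ) (p j : ℤ) : cothTanh y (-1 - p) (-j) = -cothTanh y p j := by
  have e : (2 * ((-1 - p : ℤ) : ℝ) + 1) * y / 2 = -((2 * p + 1) * y / 2) := by push_cast; ring
  rw [cothTanh, e, Real.cosh_neg, evenCsch_neg, show -1 - p - -j = -1 - (p - j) by ring,
    oddSech_neg, cothTanh]
  ring

theorem rapidDecay_cothTanh {y : ℝ} (hy : 0 < y) (p : ℤ) : RapidDecay (cothTanh y p) :=
  ((rapidDecay_evenCsch hy).mul_of_abs_le (b := fun j => oddSech y (p - j))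
    fun _ => abs_oddSech_le_one y _).const_mul _

theorem cothTanh_succ_sub {y : ℝ} (hy : 0 < y) (p : ℤ) {j : ℤ} (hj : j ≠ 0) :
    cothTanh y (p + 1) j - cothTanh y p j =
      oddTanh y (p - j + 1) - oddTanh y (p - j) := by
  rw [cothTanh_eq hy _ hj, cothTanh_eq hy _ hj, show p + 1 - j = p - j + 1 by ring]
  ring

theorem tsum_index_mul_oddTanh_succ_sub {y : ℝ} (hy : 0 < y) :
    ∑' n : ℤ, (n : ℝ) * (oddTanh y (n + 1) - oddTanh y n) = -2 := by
  have hd := summable_oddTanh_succ_sub hy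
  have h1 : ∑' n : ℤ, (n : ℝ) * (oddTanh y (n + 1) - oddTanh y n) =
      ∑' n : ℤ, ((-2 : ℝ) * (oddTanh y (n + 1) - oddTanh y n)
        - (n : ℝ) * (oddTanh y (n + 1) - oddTanh y n)) := by
    rw [← (Equiv.subLeft (-2 : ℤ)).tsum_eq]
    refine tsum_congr fun n => ?_
    rw [Equiv.subLeft_apply, show (-2 - n + 1 : ℤ) = -1 - n by ring,
      show (-2 - n : ℤ) = -1 - (n + 1) by ring, oddTanh_neg, oddTanh_neg]
    push_cast
    ring
  rw [(hd.summable.mul_left (-2)).tsum_sub hd.index_mul.summable, tsum_mul_left,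
    tsum_oddTanh_succ_sub hy] at h1
  linarith

theorem tsum_index_mul_cothTanh {y : ℝ} (hy : 0 < y) (p : ℤ) :
    ∑' j : ℤ, 2 * (j : ℝ) * cothTanh y p j =
      ∑' j : ℤ, 2 * (j : ℝ) * cothTanh y 0 j + ((2 * p + 1) ^ 2 - 1) / 2 := by
  have hs : ∀ p, Summable fun j : ℤ => 2 * (j : ℝ) * cothTanh y p j := fun p =>
    ((rapidDecay_cothTanh hy p).index_mul.const_mul 2).summable.congr fun j => by ring
  have hd := summable_oddTanh_succ_sub hy
  have hstep : ∀ p : ℤ, ∑' j : ℤ, 2 * (j : ℝ) * cothTanh y (p + 1) j =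
      ∑' j : ℤ, 2 * (j : ℝ) * cothTanh y p j + (4 * p + 4) := fun p => by
    rw [← sub_eq_iff_eq_add', ← (hs _).tsum_sub (hs _)]
    calc ∑' j : ℤ, (2 * (j : ℝ) * cothTanh y (p + 1) j - 2 * (j : ℝ) * cothTanh y p j)
        = ∑' j : ℤ, 2 * (j : ℝ) * (oddTanh y (p - j + 1) - oddTanh y (p - j)) :=
          tsum_congr fun j => by
            rcases eq_or_ne j 0 with rfl | hj
            · simp
            · rw [← cothTanh_succ_sub hy p hj]; ring
      _ = ∑' k : ℤ, (2 * (p : ℝ) * (oddTanh y (k + 1) - oddTanh y k)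
            - 2 * ((k : ℝ) * (oddTanh y (k + 1) - oddTanh y k))) := by
          rw [← (Equiv.subLeft p).tsum_eq]
          refine tsum_congr fun j => ?_
          rw [Equiv.subLeft_apply, sub_sub_cancel]
          push_cast
          ring
      _ = 4 * p + 4 := by
          rw [(hd.summable.mul_left _).tsum_sub (hd.index_mul.summable.mul_left 2),
            tsum_mul_left, tsum_mul_left, tsum_index_mul_oddTanh_succ_sub hy,
            tsum_oddTanh_succ_sub hy]
          ring
  induction p using Int.induction_on with
  | zero => simp
  | succ i ih => rw [hstep, ih]; push_cast; ring
  | pred i ih =>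
    have h := hstep (-i - 1)
    rw [sub_add_cancel, ih] at h
    push_cast at h ⊢
    linarith

theorem tsum_cothTanh {y : ℝ} (hy : 0 < y) (p : ℤ) :
    ∑' j : ℤ, cothTanh y p j = 2 * p + 1 - oddTanh y p := by
  have hs : ∀ p, Summable (cothTanh y p) := fun p => (rapidDecay_cothTanh hy p).summable
  have hd := summable_oddTanh_succ_sub hy
  have hstep : ∀ p : ℤ, ∑' j : ℤ, cothTanh y (p + 1) j =
      ∑' j : ℤ, cothTanh y p j + (2 - (oddTanh y (p + 1) - oddTanh y p)) := fun p => by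
    rw [← sub_eq_iff_eq_add', ← (hs _).tsum_sub (hs _)]
    have h1 : ∑' j : ℤ, (oddTanh y (p - j + 1) - oddTanh y (p - j)) = 2 := by
      rw [← tsum_oddTanh_succ_sub hy, ← (Equiv.subLeft p).tsum_eq
        fun n => oddTanh y (n + 1) - oddTanh y n]
      rfl
    have h2 : Summable fun j : ℤ => oddTanh y (p - j + 1) - oddTanh y (p - j) :=
      hd.summable.comp_injective (i := fun j => p - j) (Equiv.subLeft p).injective
    rw [h2.tsum_eq_add_tsum_ite 0] at h1
    rw [((hs _).sub (hs _)).tsum_eq_add_tsum_ite 0, cothTanh_zero, cothTanh_zero, sub_zero,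
      zero_add]
    rw [sub_zero] at h1
    rw [← h1, add_sub_cancel_left]
    refine tsum_congr fun j => ?_
    split_ifs with hj
    · rfl
    · exact cothTanh_succ_sub hy p hj
  have hodd : ∀ p : ℤ, ∑' j : ℤ, cothTanh y (-1 - p) j = -∑' j : ℤ, cothTanh y p j := fun p => by
    rw [← (Equiv.neg ℤ).tsum_eq, ← tsum_neg]
    exact tsum_congr fun j => cothTanh_neg y p j
  induction p using Int.induction_on with
  | zero =>
    have h := hstep (-1)
    have h1 := hodd 0
    have h2 := oddTanh_neg y 0
    norm_num at h h1 h2 ⊢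
    rw [h1, h2] at h
    linarith
  | succ i ih => rw [hstep, ih]; push_cast; ring
  | pred i ih =>
    have h := hstep (-i - 1)
    rw [sub_add_cancel, ih] at h
    push_cast at h ⊢
    linarith

/-- The `k`-th derivative of the series `∑ a n * exp (i (2 n + d) u)`. -/
noncomputable def trigSeries (a : ℤ → ℝ) (d k : ℕ) (u : ℝ) : ℂ :=
  ∑' n : ℤ, (I * (2 * n + d)) ^ k * a n * cexp (I * (2 * n + d) * u)

section TrigSeries

variable {a b : ℤ → ℝ} (d e k : ℕ) (u : ℝ)

theorem norm_cexp_I_mul (n : ℤ) : ‖cexp (I * (2 * n + d) * u)‖ = 1 := by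
  rw [show I * (2 * n + d) * u = (((2 * n + d) * u : ℝ) : ℂ) * I by push_cast; ring,
    Complex.norm_exp_ofReal_mul_I]

theorem norm_trigSeries_term (a : ℤ → ℝ) (n : ℤ) :
    ‖(I * (2 * n + d)) ^ k * a n * cexp (I * (2 * n + d) * u)‖ = |((2 : ℝ) * n + d) ^ k * a n| := by
  rw [norm_mul, norm_cexp_I_mul, mul_one, norm_mul, norm_pow, norm_mul, Complex.norm_I, one_mul,
    Complex.norm_real, Real.norm_eq_abs, abs_mul, abs_pow,
    show (2 * n + d : ℂ) = ((2 * n + d : ℝ) : ℂ) by push_cast; ring, Complex.norm_real,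
    Real.norm_eq_abs]

theorem RapidDecay.summable_norm_trigSeries (ha : RapidDecay a) :
    Summable fun n : ℤ => ‖(I * (2 * n + d)) ^ k * a n * cexp (I * (2 * n + d) * u)‖ := by
  simp_rw [norm_trigSeries_term]
  exact (ha.affine_pow_mul 2 d k).summable_abs

theorem RapidDecay.summable_trigSeries (ha : RapidDecay a) :
    Summable fun n : ℤ => (I * (2 * n + d)) ^ k * a n * cexp (I * (2 * n + d) * u) :=
  (ha.summable_norm_trigSeries d k u).of_norm

theorem RapidDecay.hasDerivAt_trigSeries (ha : RapidDecay a) :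
    HasDerivAt (trigSeries a d k) (trigSeries a d (k + 1) u) u := by
  refine hasDerivAt_tsum (ha.affine_pow_mul 2 d (k + 1)).summable_abs (fun n v => ?_)
    (fun n v => (norm_trigSeries_term d (k + 1) v a n).le) (ha.summable_trigSeries d k 0) u
  have h : HasDerivAt (fun v : ℝ => I * (2 * n + d) * (v : ℂ)) (I * (2 * n + d)) v := by
    simpa using (Complex.ofRealCLM.hasDerivAt (x := v)).const_mul (I * (2 * n + d))
  refine (h.cexp.const_mul ((I * (2 * n + d)) ^ k * a n)).congr_deriv ?_
  ring

theorem trigSeries_succ (a : ℤ → ℝ) :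
    trigSeries a d (k + 1) u = I * trigSeries (fun n => (2 * n + d) * a n) d k u := by
  unfold trigSeries
  rw [← tsum_mul_left]
  refine tsum_congr fun n => ?_
  push_cast
  ring

theorem trigSeries_const_mul (c : ℝ) (a : ℤ → ℝ) :
    trigSeries (fun n => c * a n) d k u = c * trigSeries a d k u := by
  unfold trigSeries
  rw [← tsum_mul_left]
  refine tsum_congr fun n => ?_
  push_cast
  ring

theorem trigSeries_add (ha : RapidDecay a) (hb : RapidDecay b) :
    trigSeries (fun n => a n + b n) d k u = trigSeries a d k u + trigSeries b d k u := by
  unfold trigSeries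
  rw [← (ha.summable_trigSeries d k u).tsum_add (hb.summable_trigSeries d k u)]
  refine tsum_congr fun n => ?_
  push_cast
  ring

theorem trigSeries_mul (ha : RapidDecay a) (hb : RapidDecay b) :
    trigSeries a d 0 u * trigSeries b e 0 u =
      trigSeries (fun p => ∑' n, a n * b (p - n)) (d + e) 0 u := by
  have hA := ha.summable_norm_trigSeries d 0 u
  have hB := hb.summable_norm_trigSeries e 0 u
  unfold trigSeries
  rw [tsum_mul_tsum_of_summable_norm hA hB]
  let E : ℤ × ℤ ≃ ℤ × ℤ :=
    ⟨fun x => (x.2, x.1 - x.2), fun x => (x.1 + x.2, x.1), fun x => by simp, fun x => by simp⟩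
  have hs := E.summable_iff.2 (summable_mul_of_summable_norm hA hB)
  rw [← E.tsum_eq]
  refine hs.tsum_prod.trans ?_
  refine tsum_congr fun p => ?_
  push_cast
  rw [pow_zero, one_mul, ← tsum_mul_right]
  refine tsum_congr fun n => ?_
  have h : I * (2 * p + (d + e)) * u = I * (2 * n + d) * u + I * (2 * (p - n) + e) * u := by ring
  simp only [E, Function.comp, Equiv.coe_fn_mk, pow_zero, one_mul]
  rw [h, Complex.exp_add]
  push_cast
  ring

end TrigSeries

/-- The elliptic function `∑ exp (i (2 n + 1) u) / cosh ((2 n + 1) y / 2)` and its derivatives. -/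
noncomputable def sechSeries (y : ℝ) (k : ℕ) (u : ℝ) : ℂ := trigSeries (oddSech y) 1 k u

/-- The zeta-type function `∑ exp (2 i j u) / sinh (j y)` and its derivatives. -/
noncomputable def cschSeries (y : ℝ) (k : ℕ) (u : ℝ) : ℂ := trigSeries (evenCsch y) 0 k u

/-- The series of `sechSeries` differentiated in the parameter, up to a factor `-2`. -/
noncomputable def sechTanhSeries (y : ℝ) (k : ℕ) (u : ℝ) : ℂ :=
  trigSeries (fun n => (2 * n + 1) * (oddSech y n * oddTanh y n)) 1 k u

theorem rapidDecay_sechTanh {y : ℝ} (hy : 0 < y) :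
    RapidDecay fun n => (2 * (n : ℝ) + 1) * (oddSech y n * oddTanh y n) :=
  ((rapidDecay_oddSech hy).mul_of_abs_le (abs_oddTanh_le_one y)).affine_mul 2 1

theorem exists_sechSeries_sq {y : ℝ} (hy : 0 < y) :
    ∃ P : ℝ, ∀ u, sechSeries y 0 u ^ 2 = P - I * cschSeries y 1 u := by
  refine ⟨∑' n, oddSech y n * oddSech y (0 - 1 - n), fun u => ?_⟩
  have hs := rapidDecay_oddSech hy
  have hc := rapidDecay_evenCsch hy
  have e1 : I * cschSeries y 1 u =
      -trigSeries (fun j => (2 * (j : ℝ) + (0 : ℕ)) * evenCsch y j) 0 0 u := by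
    rw [cschSeries, trigSeries_succ, ← mul_assoc, Complex.I_mul_I, neg_one_mul]
  rw [e1, sub_neg_eq_add, sq, sechSeries, trigSeries_mul 1 1 u hs hs]
  unfold trigSeries
  rw [← (Equiv.subRight (1 : ℤ)).tsum_eq]
  have hC := (hc.affine_mul 2 (0 : ℕ)).summable_trigSeries 0 0 u
  have hS : Summable fun j : ℤ => if j = 0 then
      ((∑' n, oddSech y n * oddSech y (0 - 1 - n) : ℝ) : ℂ) else 0 :=
    (hasSum_ite_eq (0 : ℤ) _).summable
  rw [← tsum_ite_eq (0 : ℤ) fun _ => ((∑' n, oddSech y n * oddSech y (0 - 1 - n) : ℝ) : ℂ),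
    ← hS.tsum_add hC]
  refine tsum_congr fun j => ?_
  simp only [Equiv.subRight_apply]
  split_ifs with hj
  · subst hj
    simp
  · rw [tsum_oddSech_mul_oddSech hy hj]
    push_cast
    ring_nf

theorem exists_sechSeries_identities {y : ℝ} (hy : 0 < y) :
    ∃ R : ℝ, ∀ u,
      -I * cschSeries y 1 u * sechSeries y 0 u = R * sechSeries y 0 u - sechSeries y 2 u / 2 ∧
      sechSeries y 1 u * cschSeries y 0 u =
        -I * (sechSeries y 2 u / 2 + sechTanhSeries y 0 u + R * sechSeries y 0 u) := by
  have hs := rapidDecay_oddSech hy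
  have hc := rapidDecay_evenCsch hy
  have hI : I * I = -1 := Complex.I_mul_I
  set R := ∑' j : ℤ, 2 * (j : ℝ) * cothTanh y 0 j with hR
  refine ⟨R - 1 / 2, fun u => ⟨?_, ?_⟩⟩
  · have e1 : -I * cschSeries y 1 u =
        trigSeries (fun j => (2 * (j : ℝ) + (0 : ℕ)) * evenCsch y j) 0 0 u := by
      rw [cschSeries, trigSeries_succ, ← mul_assoc, neg_mul, hI, neg_neg, one_mul]
    have e2 : (fun p : ℤ => ∑' j : ℤ, (2 * (j : ℝ) + (0 : ℕ)) * evenCsch y j * oddSech y (p - j)) =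
        fun p => (R - 1 / 2) * oddSech y p
          + 1 / 2 * ((2 * p + (1 : ℕ)) * ((2 * p + (1 : ℕ)) * oddSech y p)) := by
      funext p
      have h := tsum_index_mul_cothTanh hy p
      rw [← hR] at h
      calc _ = ∑' j : ℤ, oddSech y p * (2 * (j : ℝ) * cothTanh y p j) :=
            tsum_congr fun j => by
              rw [mul_left_comm, oddSech_mul_cothTanh]; push_cast; ring
        _ = _ := by rw [tsum_mul_left, h]; push_cast; ring
    rw [e1, sechSeries, sechSeries, trigSeries_mul 0 1 u (hc.affine_mul 2 (0 : ℕ)) hs, e2, zero_add,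
      trigSeries_add 1 0 u (hs.const_mul _)
        (((hs.affine_mul 2 (1 : ℕ)).affine_mul 2 (1 : ℕ)).const_mul _),
      trigSeries_const_mul, trigSeries_const_mul, trigSeries_succ, trigSeries_succ]
    push_cast
    linear_combination (1 / 2) * hI *
      trigSeries (fun n => (2 * n + 1) * ((2 * n + 1) * oddSech y n)) 1 0 u
  · have e2 : (fun p : ℤ => ∑' j : ℤ, evenCsch y j *
          ((2 * ((p - j : ℤ) : ℝ) + (1 : ℕ)) * oddSech y (p - j))) =
        fun p => 1 / 2 * ((2 * p + (1 : ℕ)) * ((2 * p + (1 : ℕ)) * oddSech y p)) +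
          (-1 * ((2 * p + 1) * (oddSech y p * oddTanh y p)) + -(R - 1 / 2) * oddSech y p) := by
      funext p
      have h := tsum_index_mul_cothTanh hy p
      rw [← hR] at h
      have hk := rapidDecay_cothTanh hy p
      calc _ = ∑' j : ℤ, oddSech y p * ((2 * p + 1) * cothTanh y p j
              - 2 * (j : ℝ) * cothTanh y p j) :=
            tsum_congr fun j => by
              rw [← sub_mul, mul_left_comm (oddSech y p), oddSech_mul_cothTanh]; push_cast; ring
        _ = _ := by
            rw [tsum_mul_left, (hk.summable.mul_left _).tsum_sub
              ((hk.index_mul.const_mul 2).summable.congr fun j => by ring), h, tsum_mul_left,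
              tsum_cothTanh hy]
            push_cast
            ring
    rw [sechSeries, sechSeries, sechSeries, cschSeries, sechTanhSeries, trigSeries_succ,
      mul_assoc, mul_comm (trigSeries _ 1 0 u),
      trigSeries_mul 0 1 u hc (hs.affine_mul 2 (1 : ℕ)), e2, zero_add,
      trigSeries_add 1 0 u (((hs.affine_mul 2 (1 : ℕ)).affine_mul 2 (1 : ℕ)).const_mul _)
        (((rapidDecay_sechTanh hy).const_mul _).add (hs.const_mul _)),
      trigSeries_add 1 0 u ((rapidDecay_sechTanh hy).const_mul _) (hs.const_mul _),
      trigSeries_const_mul, trigSeries_const_mul, trigSeries_const_mul,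
      trigSeries_succ, trigSeries_succ]
    push_cast
    linear_combination (I / 2) * hI *
      trigSeries (fun n => (2 * n + 1) * ((2 * n + 1) * oddSech y n)) 1 0 u

theorem eq_of_hasDerivAt_of_eq {f g : ℝ → ℂ} {f' g' e : ℂ} {u : ℝ} (hf : HasDerivAt f f' u)
    (h : ∀ v, f v = g v) (hg : HasDerivAt g g' u) (he : g' = e) : f' = e := by
  rw [funext h] at hf
  exact (hf.unique hg).trans he

/-- At a zero of a solution of `F'' = -2 F³`, the higher derivatives of `F` and of the companion
function `H = F' Z + F³ - R F`, where `Z' = P - F²`, are polynomials in `F'`. -/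
theorem iterated_deriv_at_zero {F H : ℕ → ℝ → ℂ} {Z : ℝ → ℂ} {P R : ℂ}
    (hF : ∀ k u, HasDerivAt (F k) (F (k + 1) u) u) (hH : ∀ k u, HasDerivAt (H k) (H (k + 1) u) u)
    (hZ : ∀ u, HasDerivAt Z (P - F 0 u ^ 2) u) (f2 : ∀ u, F 2 u = -2 * F 0 u ^ 3)
    (h0 : ∀ u, H 0 u = F 0 u ^ 3 - F 0 u * R + F 1 u * Z u) {u : ℝ} (hu : F 0 u = 0) :
    F 9 u = 3024 * F 1 u ^ 5 ∧ H 7 u = -528 * F 1 u ^ 5 := by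
  have D (i j l : ℕ) (u : ℝ) := (((hF 0 u).fun_pow i).fun_mul ((hF 1 u).fun_pow j)).fun_mul
    ((hZ u).fun_pow l)
  simp only [zero_add, Nat.reduceAdd, f2] at D
  have f3 (u) : F 3 u = -6 * F 0 u ^ 2 * F 1 u :=
    eq_of_hasDerivAt_of_eq (hF 2 u) (fun v => by rw [f2 v]; ring)
      ((D 3 0 0 u).const_mul (-2)) (by push_cast; ring)
  have f4 (u) : F 4 u = 12 * F 0 u ^ 5 - 12 * F 0 u * F 1 u ^ 2 :=
    eq_of_hasDerivAt_of_eq (hF 3 u) (fun v => by rw [f3 v]; ring)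
      ((D 2 1 0 u).const_mul (-6)) (by push_cast; ring)
  have f5 (u) : F 5 u = 108 * F 0 u ^ 4 * F 1 u - 12 * F 1 u ^ 3 :=
    eq_of_hasDerivAt_of_eq (hF 4 u) (fun v => by rw [f4 v]; ring)
      ((D 5 0 0 u).const_mul 12 |>.fun_add ((D 1 2 0 u).const_mul (-12))) (by push_cast; ring)
  have f6 (u) : F 6 u = -216 * F 0 u ^ 7 + 504 * F 0 u ^ 3 * F 1 u ^ 2 :=
    eq_of_hasDerivAt_of_eq (hF 5 u) (fun v => by rw [f5 v]; ring)
      ((D 4 1 0 u).const_mul 108 |>.fun_add ((D 0 3 0 u).const_mul (-12))) (by push_cast; ring)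
  have f7 (u) : F 7 u = -3528 * F 0 u ^ 6 * F 1 u + 1512 * F 0 u ^ 2 * F 1 u ^ 3 :=
    eq_of_hasDerivAt_of_eq (hF 6 u) (fun v => by rw [f6 v]; ring)
      ((D 7 0 0 u).const_mul (-216) |>.fun_add ((D 3 2 0 u).const_mul 504)) (by push_cast; ring)
  have f8 (u) : F 8 u = 7056 * F 0 u ^ 9 - 30240 * F 0 u ^ 5 * F 1 u ^ 2 +
      3024 * F 0 u * F 1 u ^ 4 :=
    eq_of_hasDerivAt_of_eq (hF 7 u) (fun v => by rw [f7 v]; ring)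
      ((D 6 1 0 u).const_mul (-3528) |>.fun_add ((D 2 3 0 u).const_mul 1512)) (by push_cast; ring)
  have f9 (u) : F 9 u = 184464 * F 0 u ^ 8 * F 1 u - 175392 * F 0 u ^ 4 * F 1 u ^ 3 +
      3024 * F 1 u ^ 5 :=
    eq_of_hasDerivAt_of_eq (hF 8 u) (fun v => by rw [f8 v]; ring)
      ((D 9 0 0 u).const_mul 7056 |>.fun_add ((D 5 2 0 u).const_mul (-30240))
          |>.fun_add ((D 1 4 0 u).const_mul 3024)) (by push_cast; ring)
  have h1 (u) : H 1 u = -2 * F 0 u ^ 3 * Z u + 2 * F 0 u ^ 2 * F 1 u + F 1 u * P - F 1 u * R :=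
    eq_of_hasDerivAt_of_eq (hH 0 u) (fun v => by rw [h0 v]; ring)
      ((D 3 0 0 u).const_mul 1 |>.fun_add ((D 1 0 0 u).const_mul (-1 * R))
          |>.fun_add ((D 0 1 1 u).const_mul 1)) (by push_cast; ring)
  have h2 (u) : H 2 u = -2 * F 0 u ^ 5 - 4 * F 0 u ^ 3 * P + 2 * F 0 u ^ 3 * R
      - 6 * F 0 u ^ 2 * F 1 u * Z u + 4 * F 0 u * F 1 u ^ 2 :=
    eq_of_hasDerivAt_of_eq (hH 1 u) (fun v => by rw [h1 v]; ring)
      ((D 3 0 1 u).const_mul (-2) |>.fun_add ((D 2 1 0 u).const_mul 2)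
          |>.fun_add ((D 0 1 0 u).const_mul (1 * P)) |>.fun_add ((D 0 1 0 u).const_mul (-1 * R)))
          (by push_cast; ring)
  have h3 (u) : H 3 u = 12 * F 0 u ^ 5 * Z u - 20 * F 0 u ^ 4 * F 1 u - 18 * F 0 u ^ 2 * F 1 u * P
      + 6 * F 0 u ^ 2 * F 1 u * R - 12 * F 0 u * F 1 u ^ 2 * Z u + 4 * F 1 u ^ 3 :=
    eq_of_hasDerivAt_of_eq (hH 2 u) (fun v => by rw [h2 v]; ring)
      ((D 5 0 0 u).const_mul (-2) |>.fun_add ((D 3 0 0 u).const_mul (-4 * P))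
          |>.fun_add ((D 3 0 0 u).const_mul (2 * R)) |>.fun_add ((D 2 1 1 u).const_mul (-6))
          |>.fun_add ((D 1 2 0 u).const_mul 4)) (by push_cast; ring)
  have h4 (u) : H 4 u = 28 * F 0 u ^ 7 + 48 * F 0 u ^ 5 * P - 12 * F 0 u ^ 5 * R +
      108 * F 0 u ^ 4 * F 1 u * Z u - 92 * F 0 u ^ 3 * F 1 u ^ 2 - 48 * F 0 u * F 1 u ^ 2 * P +
      12 * F 0 u * F 1 u ^ 2 * R - 12 * F 1 u ^ 3 * Z u :=
    eq_of_hasDerivAt_of_eq (hH 3 u) (fun v => by rw [h3 v]; ring)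
      ((D 5 0 1 u).const_mul 12 |>.fun_add ((D 4 1 0 u).const_mul (-20))
          |>.fun_add ((D 2 1 0 u).const_mul (-18 * P)) |>.fun_add ((D 2 1 0 u).const_mul (6 * R))
          |>.fun_add ((D 1 2 1 u).const_mul (-12)) |>.fun_add ((D 0 3 0 u).const_mul 4))
          (by push_cast; ring)
  have h5 (u) : H 5 u = -216 * F 0 u ^ 7 * Z u + 456 * F 0 u ^ 6 * F 1 u +
      540 * F 0 u ^ 4 * F 1 u * P - 108 * F 0 u ^ 4 * F 1 u * R +
      504 * F 0 u ^ 3 * F 1 u ^ 2 * Z u - 264 * F 0 u ^ 2 * F 1 u ^ 3 - 60 * F 1 u ^ 3 * P +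
      12 * F 1 u ^ 3 * R :=
    eq_of_hasDerivAt_of_eq (hH 4 u) (fun v => by rw [h4 v]; ring)
      ((D 7 0 0 u).const_mul 28 |>.fun_add ((D 5 0 0 u).const_mul (48 * P))
          |>.fun_add ((D 5 0 0 u).const_mul (-12 * R)) |>.fun_add ((D 4 1 1 u).const_mul 108)
          |>.fun_add ((D 3 2 0 u).const_mul (-92)) |>.fun_add ((D 1 2 0 u).const_mul (-48 * P))
          |>.fun_add ((D 1 2 0 u).const_mul (12 * R)) |>.fun_add ((D 0 3 1 u).const_mul (-12)))
          (by push_cast; ring)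
  have h6 (u) : H 6 u = -696 * F 0 u ^ 9 - 1296 * F 0 u ^ 7 * P + 216 * F 0 u ^ 7 * R
      - 3528 * F 0 u ^ 6 * F 1 u * Z u + 3816 * F 0 u ^ 5 * F 1 u ^ 2 +
      3024 * F 0 u ^ 3 * F 1 u ^ 2 * P - 504 * F 0 u ^ 3 * F 1 u ^ 2 * R +
      1512 * F 0 u ^ 2 * F 1 u ^ 3 * Z u - 528 * F 0 u * F 1 u ^ 4 :=
    eq_of_hasDerivAt_of_eq (hH 5 u) (fun v => by rw [h5 v]; ring)
      ((D 7 0 1 u).const_mul (-216) |>.fun_add ((D 6 1 0 u).const_mul 456)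
          |>.fun_add ((D 4 1 0 u).const_mul (540 * P))
          |>.fun_add ((D 4 1 0 u).const_mul (-108 * R)) |>.fun_add ((D 3 2 1 u).const_mul 504)
          |>.fun_add ((D 2 3 0 u).const_mul (-264)) |>.fun_add ((D 0 3 0 u).const_mul (-60 * P))
          |>.fun_add ((D 0 3 0 u).const_mul (12 * R))) (by push_cast; ring)
  have h7 (u) : H 7 u = 7056 * F 0 u ^ 9 * Z u - 18000 * F 0 u ^ 8 * F 1 u
      - 24696 * F 0 u ^ 6 * F 1 u * P + 3528 * F 0 u ^ 6 * F 1 u * R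
      - 30240 * F 0 u ^ 5 * F 1 u ^ 2 * Z u + 21792 * F 0 u ^ 4 * F 1 u ^ 3 +
      10584 * F 0 u ^ 2 * F 1 u ^ 3 * P - 1512 * F 0 u ^ 2 * F 1 u ^ 3 * R +
      3024 * F 0 u * F 1 u ^ 4 * Z u - 528 * F 1 u ^ 5 :=
    eq_of_hasDerivAt_of_eq (hH 6 u) (fun v => by rw [h6 v]; ring)
      ((D 9 0 0 u).const_mul (-696) |>.fun_add ((D 7 0 0 u).const_mul (-1296 * P))
          |>.fun_add ((D 7 0 0 u).const_mul (216 * R)) |>.fun_add ((D 6 1 1 u).const_mul (-3528))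
          |>.fun_add ((D 5 2 0 u).const_mul 3816) |>.fun_add ((D 3 2 0 u).const_mul (3024 * P))
          |>.fun_add ((D 3 2 0 u).const_mul (-504 * R)) |>.fun_add ((D 2 3 1 u).const_mul 1512)
          |>.fun_add ((D 1 4 0 u).const_mul (-528))) (by push_cast; ring)
  rw [f9, h7, hu]
  constructor <;> ring

/-- The alternating sum `a 0 - 3 ^ k * a 1 + 5 ^ k * a 2 - ...`. -/
noncomputable def altOddSum (a : ℤ → ℝ) (k : ℕ) : ℝ :=
  ∑' n : ℕ, (-1) ^ n * (2 * (n : ℝ) + 1) ^ k * a n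

section EvenTrigSeries

variable {a : ℤ → ℝ}

theorem trigSeries_of_even (ha : RapidDecay a) (he : ∀ n, a (-1 - n) = a n) (k : ℕ) (u : ℝ) :
    trigSeries a 1 k u = ∑' n : ℕ, (I * (2 * n + 1)) ^ k * a n *
      (cexp (I * (2 * n + 1) * u) + (-1) ^ k * cexp (-(I * (2 * n + 1) * u))) := by
  have hs := ha.summable_trigSeries 1 k u
  unfold trigSeries
  set f : ℤ → ℂ := fun n => (I * (2 * n + (1 : ℕ))) ^ k * a n * cexp (I * (2 * n + (1 : ℕ)) * u)
    with hf
  have h1 : Summable fun n : ℕ => f n := hs.comp_injective Nat.cast_injective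
  have h2 : Summable fun n : ℕ => f (-((n : ℤ) + 1)) :=
    hs.comp_injective (i := fun n : ℕ => -((n : ℤ) + 1)) fun a b h => by simpa using h
  rw [tsum_of_nat_of_neg_add_one h1 h2, ← h1.tsum_add h2]
  refine tsum_congr fun n => ?_
  have e : a (-((n : ℤ) + 1)) = a n := by rw [← he n]; congr 1; ring
  have e2 : (I * (2 * (-(n + 1)) + 1)) = (-1) * (I * (2 * n + 1)) := by ring
  simp only [hf, e]
  push_cast
  rw [e2, mul_pow (-1 : ℂ), neg_one_mul (I * _), neg_mul]
  ring

theorem trigSeries_zero_of_even (ha : RapidDecay a) (he : ∀ n, a (-1 - n) = a n) (u : ℝ) :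
    trigSeries a 1 0 u = ((∑' n : ℕ, 2 * a n * Real.cos ((2 * n + 1) * u) : ℝ) : ℂ) := by
  rw [trigSeries_of_even ha he, Complex.ofReal_tsum]
  refine tsum_congr fun n => ?_
  have e : I * (2 * n + 1) * u = (2 * n + 1) * u * I := by ring
  push_cast
  rw [Complex.cos, e]
  ring_nf

theorem trigSeries_one_of_even (ha : RapidDecay a) (he : ∀ n, a (-1 - n) = a n) (u : ℝ) :
    trigSeries a 1 1 u =
      ((-∑' n : ℕ, 2 * (2 * n + 1) * a n * Real.sin ((2 * n + 1) * u) : ℝ) : ℂ) := by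
  rw [trigSeries_of_even ha he, Complex.ofReal_neg, Complex.ofReal_tsum, ← tsum_neg]
  refine tsum_congr fun n => ?_
  have e : I * (2 * n + 1) * u = (2 * n + 1) * u * I := by ring
  push_cast
  rw [Complex.sin, e]
  ring_nf

theorem cexp_odd_mul_pi_div_two (n : ℕ) : cexp (I * (2 * n + 1) * (π / 2 : ℝ)) = I * (-1) ^ n := by
  have e : I * (2 * n + 1) * (π / 2 : ℝ) = n * (π * I) + π / 2 * I := by push_cast; ring
  rw [e, Complex.exp_add, Complex.exp_nat_mul, Complex.exp_pi_mul_I, Complex.exp_pi_div_two_mul_I,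
    mul_comm]

theorem cexp_neg_odd_mul_pi_div_two (n : ℕ) :
    cexp (-(I * (2 * n + 1) * (π / 2 : ℝ))) = -(I * (-1) ^ n) := by
  rw [Complex.exp_neg, cexp_odd_mul_pi_div_two, mul_inv, Complex.inv_I, ← inv_pow, inv_neg_one]
  ring

theorem trigSeries_zero_pi_div_two (ha : RapidDecay a) (he : ∀ n, a (-1 - n) = a n) :
    trigSeries a 1 0 (π / 2) = 0 := by
  rw [trigSeries_of_even ha he]
  simp_rw [cexp_odd_mul_pi_div_two, cexp_neg_odd_mul_pi_div_two]
  simp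

theorem trigSeries_odd_pi_div_two (ha : RapidDecay a) (he : ∀ n, a (-1 - n) = a n) (l : ℕ) :
    trigSeries a 1 (2 * l + 1) (π / 2) = 2 * (-1) ^ (l + 1) * altOddSum a (2 * l + 1) := by
  rw [trigSeries_of_even ha he, altOddSum, Complex.ofReal_tsum, ← tsum_mul_left]
  refine tsum_congr fun n => ?_
  rw [cexp_odd_mul_pi_div_two, cexp_neg_odd_mul_pi_div_two, mul_pow I, pow_succ I, pow_mul,
    Complex.I_sq, (odd_two_mul_add_one l).neg_one_pow]
  push_cast
  linear_combination
    (2 * (-1) ^ l * (2 * n + 1 : ℂ) ^ (2 * l + 1) * a n * (-1) ^ n) * Complex.I_mul_I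

end EvenTrigSeries

theorem oddSech_mul_oddTanh_even (y : ℝ) (n : ℤ) :
    (2 * ((-1 - n : ℤ) : ℝ) + 1) * (oddSech y (-1 - n) * oddTanh y (-1 - n)) =
      (2 * (n : ℝ) + 1) * (oddSech y n * oddTanh y n) := by
  rw [oddSech_neg, oddTanh_neg]
  push_cast
  ring

section SechSeries

variable {y : ℝ}

theorem hasDerivAt_I_mul_cschSeries (hy : 0 < y) {P : ℝ}
    (hP : ∀ u, sechSeries y 0 u ^ 2 = P - I * cschSeries y 1 u) (u : ℝ) :
    HasDerivAt (fun u => I * cschSeries y 0 u) (P - sechSeries y 0 u ^ 2) u := by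
  refine (((rapidDecay_evenCsch hy).hasDerivAt_trigSeries 0 0 u).const_mul I).congr_deriv ?_
  have h := hP u
  rw [cschSeries] at h
  rw [h, sub_sub_cancel]

/-- If the alternating cubic sum vanishes, `sechSeries y` solves `F'' = -2 F ^ 3`. -/
theorem sechSeries_two (hy : 0 < y) (h1 : altOddSum (oddSech y) 1 ≠ 0)
    (h3 : altOddSum (oddSech y) 3 = 0) (u : ℝ) :
    sechSeries y 2 u = -2 * sechSeries y 0 u ^ 3 := by
  have hs := rapidDecay_oddSech hy
  obtain ⟨P, hP⟩ := exists_sechSeries_sq hy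
  obtain ⟨R, hR⟩ := exists_sechSeries_identities hy
  have f2 (v) : sechSeries y 2 v = 2 * (P + R) * sechSeries y 0 v - 2 * sechSeries y 0 v ^ 3 := by
    linear_combination (2 * sechSeries y 0 v) * hP v + 2 * (hR v).1
  have D (k v) : HasDerivAt (sechSeries y k) (sechSeries y (k + 1) v) v :=
    hs.hasDerivAt_trigSeries 1 k v
  have f3 : sechSeries y 3 (π / 2) = 2 * (P + R) * sechSeries y 1 (π / 2) -
      2 * (3 * sechSeries y 0 (π / 2) ^ 2 * sechSeries y 1 (π / 2)) :=
    eq_of_hasDerivAt_of_eq (D 2 (π / 2)) f2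
      (((D 0 (π / 2)).const_mul _).fun_sub (((D 0 (π / 2)).fun_pow 3).const_mul 2)) (by simp)
  have e0 : sechSeries y 0 (π / 2) = 0 := trigSeries_zero_pi_div_two hs (oddSech_neg y)
  have e1 : sechSeries y 1 (π / 2) = _ := trigSeries_odd_pi_div_two hs (oddSech_neg y) 0
  have e3 : sechSeries y 3 (π / 2) = _ := trigSeries_odd_pi_div_two hs (oddSech_neg y) 1
  rw [e0, e1, e3, mul_one, mul_zero, zero_add, h3, Complex.ofReal_zero] at f3
  have hPR : (P + R : ℂ) = 0 := by
    have h1' : (altOddSum (oddSech y) 1 : ℂ) ≠ 0 := by exact_mod_cast h1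
    have : (P + R : ℂ) * altOddSum (oddSech y) 1 = 0 := by
      linear_combination f3 / 4
    exact (mul_eq_zero.1 this).resolve_right h1'
  rw [f2, hPR]
  ring

theorem altOddSum_oddSech_nine (hy : 0 < y) (h1 : altOddSum (oddSech y) 1 ≠ 0)
    (h3 : altOddSum (oddSech y) 3 = 0) :
    altOddSum (oddSech y) 9 = 48384 * altOddSum (oddSech y) 1 ^ 5 ∧
      altOddSum (fun n => oddSech y n * oddTanh y n) 8 = 8448 * altOddSum (oddSech y) 1 ^ 5 := by
  have hs := rapidDecay_oddSech hy
  have ht := rapidDecay_sechTanh hy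
  obtain ⟨P, hP⟩ := exists_sechSeries_sq hy
  obtain ⟨R, hR⟩ := exists_sechSeries_identities hy
  have f2 := sechSeries_two hy h1 h3
  have h0 (u) : sechTanhSeries y 0 u = sechSeries y 0 u ^ 3 - sechSeries y 0 u * R +
      sechSeries y 1 u * (I * cschSeries y 0 u) := by
    linear_combination (-I) * (hR u).2 + f2 u / (-2) +
      (sechSeries y 2 u / 2 + sechTanhSeries y 0 u + R * sechSeries y 0 u) * Complex.I_mul_I
  have e0 : sechSeries y 0 (π / 2) = 0 := trigSeries_zero_pi_div_two hs (oddSech_neg y)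
  have h := iterated_deriv_at_zero (fun k u => hs.hasDerivAt_trigSeries 1 k u)
    (fun k u => ht.hasDerivAt_trigSeries 1 k u) (hasDerivAt_I_mul_cschSeries hy hP) f2 h0 e0
  have e1 := trigSeries_odd_pi_div_two hs (oddSech_neg y) 0
  have e9 := trigSeries_odd_pi_div_two hs (oddSech_neg y) 4
  have e7 := trigSeries_odd_pi_div_two ht (oddSech_mul_oddTanh_even y) 3
  norm_num at e1 e7 e9
  rw [e1, e7, e9] at h
  have e8 : altOddSum (fun n => (2 * (n : ℝ) + 1) * (oddSech y n * oddTanh y n)) 7 =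
      altOddSum (fun n => oddSech y n * oddTanh y n) 8 :=
    tsum_congr fun n => by push_cast; ring
  rw [e8] at h
  constructor
  · have : ((altOddSum (oddSech y) 9 : ℝ) : ℂ) =
        ((48384 * altOddSum (oddSech y) 1 ^ 5 : ℝ) : ℂ) := by
      push_cast
      linear_combination h.1 / (-2)
    exact_mod_cast this
  · have : ((altOddSum (fun n => oddSech y n * oddTanh y n) 8 : ℝ) : ℂ) =
        ((8448 * altOddSum (oddSech y) 1 ^ 5 : ℝ) : ℂ) := by
      push_cast
      linear_combination h.2 / 2
    exact_mod_cast this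

end SechSeries

theorem tsum_int_even_add_odd {f : ℤ → ℂ} (he : Summable fun n => f (2 * n))
    (ho : Summable fun n => f (2 * n + 1)) :
    ∑' n, f n = ∑' n, f (2 * n) + ∑' n, f (2 * n + 1) := by
  have hi : Function.Injective fun n : ℤ => 2 * n := mul_right_injective₀ two_ne_zero
  have hi' : Function.Injective fun n : ℤ => 2 * n + 1 := (add_left_injective 1).comp hi
  refine ((hi.hasSum_range_iff.2 he.hasSum).add_isCompl ?_
    (hi'.hasSum_range_iff.2 ho.hasSum)).tsum_eq
  have h := Int.isCompl_even_odd
  convert h using 1 <;> ext m <;> simp [even_iff_exists_two_mul, Odd]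

/-- The constant in Lipschitz's formula for the character of conductor four. -/
noncomputable def lipschitzConst (k : ℕ) : ℂ :=
  4 ^ (k + 1) * k.factorial / (2 * I * (-2 * π * I) ^ (k + 1))

theorem summable_one_div_add_int_pow (z : ℂ) {k : ℕ} (hk : 1 ≤ k) :
    Summable fun n : ℤ => 1 / (z + n) ^ (k + 1) := by
  have h := EisensteinSeries.linear_right_summable z 1 (k := (k + 1 : ℕ)) (by lia)
  simpa only [Int.cast_one, one_mul, zpow_natCast, one_div] using h

/-- Lipschitz's formula for the character of conductor four. -/
theorem tsum_alternating_odd_pow_mul_cexp {k : ℕ} (hk : 1 ≤ k) {x : ℝ} (hx : 0 < x) :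
    ∑' n : ℕ, (-1 : ℂ) ^ n * (2 * n + 1) ^ k * cexp (-((2 * n + 1) * x)) =
      lipschitzConst k * ∑' r : ℤ, (-1 : ℂ) ^ r / (2 * r + 1 + 2 * I * x / π) ^ (k + 1) := by
  have hpi : (π : ℂ) ≠ 0 := by exact_mod_cast Real.pi_ne_zero
  let z (t : ℝ) : UpperHalfPlane := ⟨t + (x / (2 * π) : ℝ) * I, by
    have : 0 < x / (2 * π) := by positivity
    simpa [-Complex.ofReal_div] using this⟩
  have hz (t : ℝ) : (z t : ℂ) = t + x / (2 * π) * I := by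
    change (t : ℂ) + (x / (2 * π) : ℝ) * I = _
    push_cast; rfl
  have hq (t : ℝ) : cexp (2 * π * I * z t) = cexp (t * (2 * π * I)) * cexp (-x) := by
    rw [hz, ← Complex.exp_add]
    congr 1
    field_simp
    linear_combination (x : ℂ) * Complex.I_sq
  have hq1 : cexp (2 * π * I * z (1 / 4)) = I * cexp (-x) := by
    rw [hq, show ((1 / 4 : ℝ) : ℂ) * (2 * π * I) = π / 2 * I by push_cast; ring,
      Complex.exp_pi_div_two_mul_I]
  have hq3 : cexp (2 * π * I * z (3 / 4)) = -I * cexp (-x) := by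
    rw [hq, show ((3 / 4 : ℝ) : ℂ) * (2 * π * I) = π * I + π / 2 * I by push_cast; ring,
      Complex.exp_add, Complex.exp_pi_mul_I, Complex.exp_pi_div_two_mul_I, neg_one_mul]
  have h1 := EisensteinSeries.qExpansion_identity hk (z (1 / 4))
  have h3 := EisensteinSeries.qExpansion_identity hk (z (3 / 4))
  have s1 : Summable fun n : ℕ => (n : ℂ) ^ k * (I * cexp (-x)) ^ n := by
    simpa [← hq1] using summable_pow_mul_cexp k 1 (z (1 / 4))
  have s3 : Summable fun n : ℕ => (n : ℂ) ^ k * (-I * cexp (-x)) ^ n := by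
    simpa [← hq3] using summable_pow_mul_cexp k 1 (z (3 / 4))
  have t1 := (summable_one_div_add_int_pow (z (1 / 4)) hk).mul_left ((4 ^ (k + 1))⁻¹)
  have t3 := (summable_one_div_add_int_pow (z (3 / 4)) hk).mul_left (-(4 ^ (k + 1))⁻¹)
  have e1 (n : ℤ) : (-1 : ℂ) ^ (2 * n) / (2 * (2 * n : ℤ) + 1 + 2 * I * x / π) ^ (k + 1) =
      (4 ^ (k + 1))⁻¹ * (1 / (z (1 / 4) + n) ^ (k + 1)) := by
    rw [(even_two_mul n).neg_one_zpow, hz, one_div, one_div, ← mul_inv, ← mul_pow]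
    congr 2
    push_cast
    field_simp
    ring
  have e3 (n : ℤ) : (-1 : ℂ) ^ (2 * n + 1) / (2 * (2 * n + 1 : ℤ) + 1 + 2 * I * x / π) ^ (k + 1) =
      -(4 ^ (k + 1))⁻¹ * (1 / (z (3 / 4) + n) ^ (k + 1)) := by
    rw [(odd_two_mul_add_one n).neg_one_zpow, hz, neg_div, one_div, one_div, neg_mul, ← mul_inv,
      ← mul_pow]
    congr 3
    push_cast
    field_simp
    ring
  rw [tsum_int_even_add_odd (t1.congr fun n => (e1 n).symm) (t3.congr fun n => (e3 n).symm)]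
  simp_rw [e1, e3]
  rw [tsum_mul_left, tsum_mul_left, h1, h3, hq1, hq3]
  have h : ∑' n : ℕ, (n : ℂ) ^ k * (I * cexp (-x)) ^ n -
      ∑' n : ℕ, (n : ℂ) ^ k * (-I * cexp (-x)) ^ n =
      2 * I * ∑' n : ℕ, (-1 : ℂ) ^ n * (2 * n + 1) ^ k * cexp (-((2 * n + 1) * x)) := by
    set F : ℕ → ℂ := fun n => (n : ℂ) ^ k * (I * cexp (-x)) ^ n - (n : ℂ) ^ k * (-I * cexp (-x)) ^ n
      with hF
    have s : Summable F := s1.sub s3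
    have se : Summable fun n => F (2 * n) := s.comp_injective (mul_right_injective₀ two_ne_zero)
    have so : Summable fun n => F (2 * n + 1) :=
      s.comp_injective ((add_left_injective 1).comp (mul_right_injective₀ two_ne_zero))
    have he (n : ℕ) : F (2 * n) = 0 := by
      simp only [hF]
      rw [neg_mul, (even_two_mul n).neg_pow, sub_self]
    have ho (n : ℕ) : F (2 * n + 1) =
        2 * I * ((-1 : ℂ) ^ n * (2 * n + 1) ^ k * cexp (-((2 * n + 1) * x))) := by
      simp only [hF]
      rw [neg_mul, (odd_two_mul_add_one n).neg_pow, mul_pow, pow_succ I, pow_mul, Complex.I_sq,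
        ← Complex.exp_nat_mul]
      push_cast
      ring_nf
    rw [← s1.tsum_sub s3, ← tsum_even_add_odd se so]
    simp_rw [he, ho]
    rw [tsum_zero, zero_add, tsum_mul_left]
  generalize ∑' n : ℕ, (n : ℂ) ^ k * (I * cexp (-x)) ^ n = A at h ⊢
  generalize ∑' n : ℕ, (n : ℂ) ^ k * (-I * cexp (-x)) ^ n = B at h ⊢
  have hI := Complex.I_ne_zero
  have hk' : (k.factorial : ℂ) ≠ 0 := by exact_mod_cast k.factorial_ne_zero
  rw [lipschitzConst]
  have h2 : (-2 * π * I : ℂ) ^ (k + 1) ≠ 0 := pow_ne_zero _ (by simp [hpi])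
  generalize (-2 * π * I : ℂ) ^ (k + 1) = c at *
  field_simp
  linear_combination -h

theorem hasSum_inv_cosh {w : ℝ} (hw : 0 < w) :
    HasSum (fun j : ℕ => 2 * (-1) ^ j * Real.exp (-((2 * j + 1) * w))) (Real.cosh w)⁻¹ := by
  have h1 : ‖-Real.exp (-(2 * w))‖ < 1 := by
    rw [norm_neg, Real.norm_eq_abs, Real.abs_exp, Real.exp_lt_one_iff]
    linarith
  have h := (hasSum_geometric_of_norm_lt_one h1).mul_left (2 * Real.exp (-w))
  have e1 (j : ℕ) : 2 * (-1) ^ j * Real.exp (-((2 * j + 1) * w)) =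
      2 * Real.exp (-w) * (-Real.exp (-(2 * w))) ^ j := by
    rw [neg_pow (Real.exp _), ← Real.exp_nat_mul,
      show -((2 * j + 1) * w) = -w + j * (-(2 * w)) by ring,
      Real.exp_add]
    ring
  have e2 : (Real.cosh w)⁻¹ = 2 * Real.exp (-w) * (1 - -Real.exp (-(2 * w)))⁻¹ := by
    rw [sub_neg_eq_add, Real.cosh_eq, show -(2 * w) = -w + -w by ring, Real.exp_add, Real.exp_neg]
    have := (Real.exp_pos w).ne'
    field_simp
  rw [e2]
  simp_rw [e1]
  exact h

/-- The terms of the level-four Eisenstein series `oddLatticeSum`. -/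
noncomputable def oddLatticeTerm (k : ℕ) (w : ℝ) (j r : ℤ) : ℂ :=
  (-1) ^ j * (-1) ^ r / (2 * r + 1 + I * (2 * j + 1) * w) ^ (k + 1)

/-- The level-four Eisenstein series `∑ (-1) ^ (j + r) / (2 r + 1 + (2 j + 1) i w) ^ (k + 1)`. -/
noncomputable def oddLatticeSum (k : ℕ) (w : ℝ) : ℂ :=
  ∑' j : ℤ, ∑' r : ℤ, oddLatticeTerm k w j r

theorem summable_oddLattice {k : ℕ} (hk : 2 ≤ k) {w : ℝ} (hw : 0 < w) :
    Summable (Function.uncurry (oddLatticeTerm k w)) := by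
  let z : UpperHalfPlane := ⟨w * I, by simpa using hw⟩
  have hinj : Function.Injective fun p : ℤ × ℤ => (2 * p.1 + 1, 2 * p.2 + 1) := by
    rintro ⟨a, b⟩ ⟨c, d⟩ h
    simpa using h
  have h := ((summable_prod_eisSummand (k := k + 1) (by lia) z).comp_injective hinj).norm
  refine Summable.of_norm (h.congr fun p => ?_)
  have e : (z : ℂ) = w * I := rfl
  have hs (j : ℤ) : ‖(-1 : ℂ) ^ j‖ = 1 := by simp [norm_zpow]
  simp only [Function.comp, EisensteinSeries.eisSummand, e, Function.uncurry, oddLatticeTerm]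
  rw [norm_div, norm_mul, hs, hs, one_mul, one_div, ← norm_inv]
  push_cast
  rw [← zpow_natCast, ← zpow_neg]
  simp
  ring_nf

theorem neg_one_zpow_neg_one_sub (j : ℤ) : (-1 : ℂ) ^ (-1 - j) = -(-1) ^ j := by
  rw [zpow_sub₀ (by norm_num)]
  rcases Int.even_or_odd j with h | h
  · simp [h.neg_one_zpow]
  · simp [h.neg_one_zpow]

theorem oddLatticeSum_inv {k : ℕ} (hk : 2 ≤ k) (hI : I ^ (k + 1) = 1) {w : ℝ} (hw : 0 < w) :
    oddLatticeSum k w⁻¹ = -w ^ (k + 1) * oddLatticeSum k w := by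
  have hw' : (w : ℂ) ≠ 0 := by exact_mod_cast hw.ne'
  unfold oddLatticeSum
  rw [← Summable.tsum_comm (summable_oddLattice hk hw), ← tsum_mul_left]
  refine tsum_congr fun j => ?_
  rw [← tsum_mul_left, ← (Equiv.subLeft (-1 : ℤ)).tsum_eq]
  refine tsum_congr fun r => ?_
  have e : (2 * ((-1 - r : ℤ) : ℂ) + 1 + I * (2 * j + 1) * (w⁻¹ : ℝ)) =
      I * (w : ℂ)⁻¹ * (2 * j + 1 + I * (2 * r + 1) * w) := by
    push_cast
    field_simp
    linear_combination (-(2 * r + 1) * w : ℂ) * Complex.I_sq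
  rw [Equiv.subLeft_apply, oddLatticeTerm, oddLatticeTerm, neg_one_zpow_neg_one_sub, e, mul_pow,
    mul_pow, hI, inv_pow, one_mul,
    ← div_div, div_inv_eq_mul]
  ring

theorem summable_alternating_lambert (k : ℕ) {y : ℝ} (hy : 0 < y) :
    Summable fun p : ℕ × ℕ => (-1 : ℂ) ^ p.1 * (2 * p.1 + 1) ^ k *
      (2 * (-1) ^ p.2 * cexp (-((2 * p.2 + 1) * ((2 * p.1 + 1) * y / 2)))) := by
  have h1 : Summable fun n : ℕ => (2 * (n : ℝ) + 1) ^ k * Real.exp (-y * n) := by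
    have h := ((rapidDecay_exp_neg_abs hy).affine_pow_mul 2 1 k).summable
    simpa [Function.comp_def] using h.comp_injective (i := fun n : ℕ => (n : ℤ)) Nat.cast_injective
  have h2 : Summable fun n : ℕ => 2 * Real.exp (-y * n) := by
    have h := ((rapidDecay_exp_neg_abs hy).const_mul 2).summable
    simpa [Function.comp_def] using h.comp_injective (i := fun n : ℕ => (n : ℤ)) Nat.cast_injective
  refine Summable.of_norm_bounded (h1.mul_of_nonneg h2 (fun n => by positivity)
    (fun n => by positivity)) fun p => ?_
  have e : (-((2 * p.2 + 1) * ((2 * p.1 + 1) * y / 2)) : ℂ) =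
      ((-((2 * p.2 + 1) * ((2 * p.1 + 1) * y / 2)) : ℝ) : ℂ) := by push_cast; rfl
  have e2 : (2 * p.1 + 1 : ℂ) = ((2 * p.1 + 1 : ℝ) : ℂ) := by push_cast; rfl
  rw [e, norm_mul, norm_mul, norm_mul, norm_mul, norm_pow, norm_pow, norm_pow, norm_neg, norm_one,
    one_pow, one_pow, one_mul, mul_one, Complex.norm_exp_ofReal, Complex.norm_ofNat, e2,
    Complex.norm_real, Real.norm_of_nonneg (by positivity), mul_assoc, mul_left_comm (Real.exp _),
    ← Real.exp_add]
  gcongr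
  have : 0 ≤ (p.1 : ℝ) * p.2 * y := by positivity
  nlinarith

theorem altOddSum_oddSech_eq_oddLatticeSum {k : ℕ} (hk : 1 ≤ k) (hk' : Even (k + 1)) {y : ℝ}
    (hy : 0 < y) (hs : Summable fun j : ℤ => ∑' r : ℤ, oddLatticeTerm k (y / π) j r) :
    (altOddSum (oddSech y) k : ℂ) = lipschitzConst k * oddLatticeSum k (y / π) := by
  set G : ℤ → ℂ := fun j => ∑' r : ℤ, oddLatticeTerm k (y / π) j r with hG
  have hGe (j : ℤ) : G (-1 - j) = G j := by
    simp only [hG]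
    rw [← (Equiv.subLeft (-1 : ℤ)).tsum_eq]
    refine tsum_congr fun r => ?_
    have e : (2 * ((-1 - r : ℤ) : ℂ) + 1 + I * (2 * ((-1 - j : ℤ) : ℂ) + 1) * (y / π : ℝ)) =
        -(2 * r + 1 + I * (2 * j + 1) * (y / π : ℝ)) := by
      push_cast; ring
    rw [Equiv.subLeft_apply, oddLatticeTerm, oddLatticeTerm, neg_one_zpow_neg_one_sub,
      neg_one_zpow_neg_one_sub,
      e, hk'.neg_pow, neg_mul_neg]
  have h1 : Summable fun n : ℕ => G n := hs.comp_injective Nat.cast_injective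
  have e2 (n : ℕ) : G (-((n : ℤ) + 1)) = G n := by
    rw [← hGe n]
    congr 1
    ring
  have hsum : oddLatticeSum k (y / π) = 2 * ∑' n : ℕ, G n := by
    unfold oddLatticeSum
    rw [tsum_of_nat_of_neg_add_one (f := G) h1 (h1.congr fun n => (e2 n).symm)]
    simp_rw [e2]
    ring
  rw [hsum, altOddSum, Complex.ofReal_tsum]
  have hrow (n : ℕ) : (((-1) ^ n * (2 * (n : ℝ) + 1) ^ k * oddSech y n : ℝ) : ℂ) =
      ∑' j : ℕ, (-1 : ℂ) ^ n * (2 * n + 1) ^ k *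
        (2 * (-1) ^ j * cexp (-((2 * j + 1) * ((2 * n + 1) * y / 2)))) := by
    have h := hasSum_inv_cosh (w := (2 * n + 1) * y / 2) (by positivity)
    rw [tsum_mul_left, oddSech, Int.cast_natCast, ← h.tsum_eq]
    push_cast
    rfl
  simp_rw [hrow]
  rw [Summable.tsum_comm (f := fun j n : ℕ => (-1 : ℂ) ^ n * (2 * n + 1) ^ k *
    (2 * (-1) ^ j * cexp (-((2 * j + 1) * ((2 * n + 1) * y / 2)))))
    (summable_alternating_lambert k hy).prod_symm, ← tsum_mul_left, ← tsum_mul_left]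
  refine tsum_congr fun j => ?_
  have hL := tsum_alternating_odd_pow_mul_cexp hk (x := (2 * j + 1) * y / 2) (by positivity)
  have e (r : ℤ) : (2 * r + 1 + 2 * I * (((2 * j + 1) * y / 2 : ℝ) : ℂ) / π) =
      2 * r + 1 + I * (2 * (j : ℤ) + 1) * (y / π : ℝ) := by
    push_cast; ring
  simp_rw [e] at hL
  calc _ = 2 * (-1) ^ j * ∑' n : ℕ, (-1 : ℂ) ^ n * (2 * n + 1) ^ k *
        cexp (-((2 * n + 1) * ((2 * j + 1) * y / 2 : ℝ))) := by
        rw [← tsum_mul_left]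
        refine tsum_congr fun n => ?_
        push_cast
        ring_nf
    _ = _ := by
        rw [hL]
        simp only [hG, oddLatticeTerm]
        simp_rw [mul_div_assoc]
        rw [tsum_mul_left, zpow_natCast]
        ring

/-- The modular functional equation of `∑ (-1) ^ n (2 n + 1) ^ k / cosh ((2 n + 1) y / 2)`. -/
theorem altOddSum_oddSech_functional {k : ℕ} (hk : 2 ≤ k) (hI : I ^ (k + 1) = 1)
    (hk' : Even (k + 1)) {y : ℝ} (hy : 0 < y) :
    altOddSum (oddSech (π ^ 2 / y)) k = -(y / π) ^ (k + 1) * altOddSum (oddSech y) k := by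
  have hw : 0 < y / π := by positivity
  have hw' : 0 < π ^ 2 / y / π := by positivity
  have h1 := altOddSum_oddSech_eq_oddLatticeSum (by lia) hk' hy (summable_oddLattice hk hw).prod
  have h2 := altOddSum_oddSech_eq_oddLatticeSum (y := π ^ 2 / y) (by lia) hk' (by positivity)
    (summable_oddLattice hk hw').prod
  have e : π ^ 2 / y / π = (y / π)⁻¹ := by field_simp
  rw [e, oddLatticeSum_inv hk hI hw] at h2
  have : ((altOddSum (oddSech (π ^ 2 / y)) k : ℝ) : ℂ) =
      ((-(y / π) ^ (k + 1) * altOddSum (oddSech y) k : ℝ) : ℂ) := by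
    rw [h2]
    push_cast at h1 ⊢
    rw [h1]
    ring
  exact_mod_cast this

theorem hasDerivAt_oddSech (n : ℤ) (y : ℝ) :
    HasDerivAt (fun y => oddSech y n)
      ((2 * (n : ℝ) + 1) * (-(1 / 2) * (oddSech y n * oddTanh y n))) y := by
  have h := (((hasDerivAt_id y).const_mul (2 * (n : ℝ) + 1)).div_const 2).cosh.inv
    (Real.cosh_pos _).ne'
  refine h.congr_deriv ?_
  unfold oddTanh oddSech
  simp only [id, mul_one]
  field_simp

theorem oddTanh_sq (y : ℝ) (n : ℤ) : oddTanh y n ^ 2 = 1 - oddSech y n ^ 2 := by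
  unfold oddTanh oddSech
  have h := Real.cosh_sq ((2 * n + 1) * y / 2)
  have := (Real.cosh_pos ((2 * n + 1) * y / 2)).ne'
  field_simp
  linarith

theorem hasDerivAt_oddTanh (n : ℤ) (y : ℝ) :
    HasDerivAt (fun y => oddTanh y n) ((2 * (n : ℝ) + 1) * (1 / 2 * oddSech y n ^ 2)) y := by
  have h := (((hasDerivAt_id y).const_mul (2 * (n : ℝ) + 1)).div_const 2).sinh.fun_mul
    (hasDerivAt_oddSech n y)
  refine h.congr_deriv ?_
  have h1 : Real.cosh ((2 * (n : ℝ) + 1) * y / 2) * oddSech y n = 1 :=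
    mul_inv_cancel₀ (Real.cosh_pos _).ne'
  have h2 : Real.sinh ((2 * (n : ℝ) + 1) * y / 2) * oddSech y n = oddTanh y n := rfl
  have h3 := oddTanh_sq y n
  simp only [id]
  linear_combination (2 * n + 1) / 2 * h1 - (2 * n + 1) / 2 * oddTanh y n * h2 - (2 * n + 1) / 2 * h3

theorem hasDerivAt_oddSech_mul_oddTanh (n : ℤ) (y : ℝ) :
    HasDerivAt (fun y => oddSech y n * oddTanh y n)
      ((2 * (n : ℝ) + 1) * (oddSech y n ^ 3 - 1 / 2 * oddSech y n)) y := by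
  refine ((hasDerivAt_oddSech n y).fun_mul (hasDerivAt_oddTanh n y)).congr_deriv ?_
  linear_combination (-(2 * n + 1) / 2 * oddSech y n) * oddTanh_sq y n

theorem oddSech_le_oddSech {x y : ℝ} (hx : 0 ≤ x) (h : x ≤ y) (n : ℤ) :
    oddSech y n ≤ oddSech x n := by
  refine inv_anti₀ (Real.cosh_pos _) (Real.cosh_le_cosh.2 ?_)
  rw [abs_div, abs_div, abs_mul, abs_mul, abs_of_nonneg hx, abs_of_nonneg (hx.trans h)]
  gcongr

theorem RapidDecay.summable_altOddSum {a : ℤ → ℝ} (ha : RapidDecay a) (k : ℕ) :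
    Summable fun n : ℕ => (-1) ^ n * (2 * (n : ℝ) + 1) ^ k * a n := by
  have h := (ha.affine_pow_mul 2 1 k).summable_abs.comp_injective
    (i := fun n : ℕ => (n : ℤ)) Nat.cast_injective
  refine Summable.of_norm (h.congr fun n => ?_)
  simp [abs_mul]

theorem hasDerivAt_altOddSum {a b : ℝ → ℤ → ℝ} {C : ℝ}
    (hd : ∀ n y, HasDerivAt (fun y => a y n) ((2 * (n : ℝ) + 1) * b y n) y)
    (ha : ∀ y, 0 < y → RapidDecay (a y)) (hb : ∀ y n, |b y n| ≤ C * oddSech y n) (k : ℕ) {y : ℝ}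
    (hy : 1 < y) : HasDerivAt (fun y => altOddSum (a y) k) (altOddSum (b y) (k + 1)) y := by
  have hC : 0 ≤ C := by
    have h := (abs_nonneg _).trans (hb 1 0)
    exact nonneg_of_mul_nonneg_left h (oddSech_pos 1 0)
  have hs : Summable fun n : ℕ => (2 * (n : ℝ) + 1) ^ (k + 1) * (C * oddSech 1 n) := by
    have h := (((rapidDecay_oddSech one_pos).const_mul C).affine_pow_mul 2 1 (k + 1)).summable
    simpa [Function.comp_def] using
      h.comp_injective (i := fun n : ℕ => (n : ℤ)) Nat.cast_injective
  refine hasDerivAt_tsum_of_isPreconnected hs (isOpen_Ioi (a := 1)) isPreconnected_Ioi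
    (g' := fun (n : ℕ) y => (-1) ^ n * (2 * (n : ℝ) + 1) ^ (k + 1) * b y n) (fun n v _ => ?_)
    (fun n v hv => ?_) hy ((ha y (by linarith)).summable_altOddSum k) hy
  · refine ((hd n v).const_mul _).congr_deriv ?_
    push_cast
    ring
  · have hv' : (1 : ℝ) ≤ v := (Set.mem_Ioi.1 hv).le
    rw [norm_mul, norm_mul, norm_pow, norm_neg, norm_one, one_pow, one_mul,
      Real.norm_of_nonneg (by positivity), Real.norm_eq_abs]
    have h1 := oddSech_le_oddSech zero_le_one hv' n
    have h2 := hb v n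
    gcongr
    exact h2.trans (by gcongr)

theorem second_deriv_of_functional {f f' : ℝ → ℝ} {f₂ : ℝ}
    (h : ∀ y, 0 < y → f (π ^ 2 / y) = -(y / π) ^ 8 * f y)
    (hf : ∀ y, 1 < y → HasDerivAt f (f' y) y) (hf' : HasDerivAt f' f₂ π) :
    f₂ = -9 / π * f' π := by
  have hpi := Real.pi_pos
  have hpi1 : 1 < π := by linarith [Real.pi_gt_three]
  have e : π ^ 2 / π = π := by field_simp
  have f0 : f π = 0 := by
    have := h π hpi
    rw [e, div_self hpi.ne'] at this
    linarith
  have hinv (y : ℝ) (hy : y ≠ 0) : HasDerivAt (fun y => π ^ 2 / y) (-π ^ 2 / y ^ 2) y := by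
    simpa [div_eq_mul_inv] using (hasDerivAt_inv hy).const_mul (π ^ 2)
  have h1 : ∀ᶠ y in 𝓝 π, f' (π ^ 2 / y) * (-π ^ 2 / y ^ 2) =
      -(8 * y ^ 7 / π ^ 8) * f y - (y / π) ^ 8 * f' y := by
    have hlt : ∀ᶠ y in 𝓝 π, y < π ^ 2 := Iio_mem_nhds (by nlinarith)
    filter_upwards [Ioi_mem_nhds hpi1, hlt] with y hy hy'
    have hy1 : 1 < y := hy
    have hy0 : 0 < y := by linarith
    have hc := (hf (π ^ 2 / y) ((one_lt_div hy0).2 hy')).comp y (hinv y hy0.ne')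
    have hr := ((((hasDerivAt_id y).div_const π).fun_pow 8).fun_neg).fun_mul (hf y hy1)
    have heq : f ∘ (fun y => π ^ 2 / y) =ᶠ[𝓝 y] fun y => -(y / π) ^ 8 * f y := by
      filter_upwards [Ioi_mem_nhds hy0] with v hv using h v hv
    rw [hc.unique (hr.congr_of_eventuallyEq heq)]
    simp only [id, div_pow]
    field_simp
    push_cast
    ring
  have hl : HasDerivAt (fun y => f' (π ^ 2 / y) * (-π ^ 2 / y ^ 2))
      (f₂ * (-π ^ 2 / π ^ 2) * (-π ^ 2 / π ^ 2) + f' π * (2 * π ^ 2 / π ^ 3)) π := by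
    have hc : HasDerivAt (fun y => f' (π ^ 2 / y)) (f₂ * (-π ^ 2 / π ^ 2)) π :=
      HasDerivAt.comp (h₂ := f') π (by rwa [e]) (hinv π hpi.ne')
    have hq : HasDerivAt (fun y : ℝ => -π ^ 2 / y ^ 2) (2 * π ^ 2 / π ^ 3) π := by
      refine ((hasDerivAt_const π (-π ^ 2)).fun_div (hasDerivAt_pow 2 π)
        (by positivity)).congr_deriv ?_
      field_simp
      push_cast
      ring
    refine (hc.fun_mul hq).congr_deriv ?_
    rw [e]
  have hr : HasDerivAt (fun y => -(8 * y ^ 7 / π ^ 8) * f y - (y / π) ^ 8 * f' y)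
      (-(8 / π) * f' π - (8 / π * f' π + f₂)) π := by
    refine ((((((hasDerivAt_pow 7 π).const_mul 8).div_const (π ^ 8)).fun_neg).fun_mul
      (hf π hpi1)).fun_sub ((((hasDerivAt_id π).div_const π).fun_pow 8).fun_mul hf')).congr_deriv ?_
    simp only [id, f0]
    field_simp
    push_cast
    ring
  have := (hl.congr_of_eventuallyEq (h1.mono fun _ hy => hy.symm)).unique hr
  field_simp at this ⊢
  linarith

theorem abs_oddSech_mul_oddTanh_le (y : ℝ) (n : ℤ) :
    |-(1 / 2) * (oddSech y n * oddTanh y n)| ≤ 3 / 2 * oddSech y n := by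
  have h := oddSech_pos y n
  have h2 := abs_oddTanh_le_one y n
  rw [abs_mul, abs_mul, abs_of_pos h, abs_neg, abs_of_pos (by norm_num : (0 : ℝ) < 1 / 2)]
  nlinarith

theorem abs_oddSech_cubed_le (y : ℝ) (n : ℤ) :
    |oddSech y n ^ 3 - 1 / 2 * oddSech y n| ≤ 3 / 2 * oddSech y n := by
  have h := oddSech_pos y n
  have h1 := oddSech_le_one y n
  have h3 : oddSech y n ^ 3 ≤ oddSech y n := pow_le_of_le_one h.le h1 (by norm_num)
  rw [abs_le]
  constructor <;> nlinarith [pow_pos h 3]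

theorem RapidDecay.oddSech_cubed {y : ℝ} (hy : 0 < y) : RapidDecay fun n => oddSech y n ^ 3 := by
  refine (rapidDecay_oddSech hy).of_abs_le 1 fun n => ?_
  rw [abs_pow, one_mul]
  exact pow_le_of_le_one (abs_nonneg _) (abs_oddSech_le_one y n) (by norm_num)

/-- The cubic sum in terms of sums with a single hyperbolic secant. -/
theorem altOddSum_oddSech_cubed_pi :
    altOddSum (fun n => oddSech π n ^ 3) 9 = altOddSum (oddSech π) 9 / 2 -
      9 / π * altOddSum (fun n => oddSech π n * oddTanh π n) 8 := by
  have hpi1 : 1 < π := by linarith [Real.pi_gt_three]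
  have h1 (y : ℝ) (hy : 1 < y) := hasDerivAt_altOddSum hasDerivAt_oddSech
    (fun y hy => rapidDecay_oddSech hy) abs_oddSech_mul_oddTanh_le 7 hy
  have h2 := hasDerivAt_altOddSum hasDerivAt_oddSech_mul_oddTanh
    (fun y hy => (rapidDecay_oddSech hy).mul_of_abs_le (abs_oddTanh_le_one y))
    abs_oddSech_cubed_le 8 hpi1
  have e1 (y : ℝ) : altOddSum (fun n => -(1 / 2) * (oddSech y n * oddTanh y n)) 8 =
      -(1 / 2) * altOddSum (fun n => oddSech y n * oddTanh y n) 8 := by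
    rw [altOddSum, altOddSum, ← tsum_mul_left]
    exact tsum_congr fun n => by ring
  have e2 : altOddSum (fun n => oddSech π n ^ 3 - 1 / 2 * oddSech π n) 9 =
      altOddSum (fun n => oddSech π n ^ 3) 9 - 1 / 2 * altOddSum (oddSech π) 9 := by
    rw [altOddSum, altOddSum, altOddSum, ← tsum_mul_left,
      ← ((RapidDecay.oddSech_cubed Real.pi_pos).summable_altOddSum 9).tsum_sub
        (((rapidDecay_oddSech Real.pi_pos).summable_altOddSum 9).mul_left _)]
    exact tsum_congr fun n => by ring
  have hI : I ^ 8 = 1 := by rw [show 8 = 2 * 4 from rfl, pow_mul, Complex.I_sq]; norm_num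
  have h := second_deriv_of_functional
    (fun y hy => altOddSum_oddSech_functional (k := 7) (by norm_num) hI (by decide) hy)
    (fun y hy => (h1 y hy).congr_deriv (e1 y)) (h2.const_mul (-(1 / 2)))
  rw [e2] at h
  have := Real.pi_pos
  field_simp at h ⊢
  linarith

theorem abs_sin_nat_mul_le (m : ℕ) (u : ℝ) : |Real.sin (m * u)| ≤ m * |Real.sin u| := by
  induction m with
  | zero => simp
  | succ m ih =>
    push_cast
    rw [add_mul, one_mul, Real.sin_add]
    refine (abs_add_le _ _).trans ?_
    rw [abs_mul, abs_mul]
    have h1 := Real.abs_cos_le_one u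
    have h2 := Real.abs_cos_le_one (m * u)
    nlinarith [abs_nonneg (Real.sin (m * u)), abs_nonneg (Real.sin u)]

theorem twenty_le_exp_pi : 20 ≤ Real.exp π := by
  have h1 := Real.exp_one_gt_d9
  have h2 : Real.exp 3 = Real.exp 1 ^ 3 := by rw [← Real.exp_nat_mul]; norm_num
  have h3 : Real.exp 3 ≤ Real.exp π := Real.exp_le_exp.2 Real.pi_gt_three.le
  have h4 : (2.71828 : ℝ) ^ 3 ≤ Real.exp 1 ^ 3 := by gcongr; linarith
  norm_num at h4
  linarith

theorem two_mul_add_three_sq_le (n : ℕ) : (2 * (n : ℝ) + 3) ^ 2 ≤ 9 * 3 ^ n := by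
  induction n with
  | zero => norm_num
  | succ n ih =>
    push_cast
    rw [pow_succ 3]
    nlinarith [(Nat.cast_nonneg n : (0 : ℝ) ≤ n)]

theorem oddSech_pi_succ_le (n : ℕ) :
    (2 * (n : ℝ) + 3) ^ 2 * oddSech π (n + 1 : ℕ) ≤ 1 / 2 * oddSech π 0 * (3 / 20) ^ n := by
  have hc : 0 < Real.cosh (π / 2) := Real.cosh_pos _
  have h0 : oddSech π 0 = (Real.cosh (π / 2))⁻¹ := by simp [oddSech]
  have h1 : oddSech π (n + 1 : ℕ) ≤ 2 * (Real.exp (π / 2))⁻¹ * (Real.exp π)⁻¹ ^ (n + 1) := by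
    refine (inv_cosh_le _).trans_eq ?_
    rw [abs_of_nonneg (by positivity), mul_assoc, ← Real.exp_neg, ← Real.exp_neg,
      ← Real.exp_nat_mul, ← Real.exp_add]
    congr 2
    push_cast
    ring
  have h2 : (Real.exp π)⁻¹ ≤ 1 / 20 := by
    rw [one_div]
    exact inv_anti₀ (by norm_num) twenty_le_exp_pi
  have h3 : 2 * (Real.exp (π / 2))⁻¹ ≤ 21 / 20 * oddSech π 0 := by
    have he := Real.exp_pos (π / 2)
    have hsq : Real.exp π = Real.exp (π / 2) * Real.exp (π / 2) := by
      rw [← Real.exp_add]; ring_nf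
    have h20 := twenty_le_exp_pi
    rw [h0, ← div_eq_mul_inv, ← div_eq_mul_inv, div_le_div_iff₀ he hc, Real.cosh_eq, Real.exp_neg]
    field_simp
    nlinarith
  have h4 := two_mul_add_three_sq_le n
  have h5 := oddSech_pos π 0
  have h6 := oddSech_pos π (n + 1 : ℕ)
  calc (2 * (n : ℝ) + 3) ^ 2 * oddSech π (n + 1 : ℕ)
      ≤ 9 * 3 ^ n * (21 / 20 * oddSech π 0 * (1 / 20) ^ (n + 1)) := by
        gcongr
        refine h1.trans ?_
        gcongr
    _ = 189 / 400 * oddSech π 0 * (3 / 20) ^ n := by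
        rw [pow_succ, div_pow, div_pow]
        field_simp
        norm_num
    _ ≤ _ := by
        refine mul_le_mul_of_nonneg_right ?_ (by positivity)
        linarith

theorem tsum_oddSech_pi_sin_pos {u : ℝ} (hu : 0 < Real.sin u) :
    0 < ∑' n : ℕ, 2 * (2 * (n : ℝ) + 1) * oddSech π n * Real.sin ((2 * n + 1) * u) := by
  have hs : Summable fun n : ℕ =>
      2 * (2 * (n : ℝ) + 1) * oddSech π n * Real.sin ((2 * n + 1) * u) := by
    have h := (((rapidDecay_oddSech Real.pi_pos).affine_mul 2 1).mul_of_abs_le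
      (b := fun n => Real.sin ((2 * n + 1) * u)) (fun n => Real.abs_sin_le_one _)).summable
    refine ((h.comp_injective (i := fun n : ℕ => (n : ℤ)) Nat.cast_injective).mul_left 2).congr
      fun n => ?_
    simp [mul_assoc]
  have h0 := oddSech_pos π 0
  have hg := (hasSum_geometric_of_lt_one (r := 3 / 20) (by norm_num) (by norm_num)).mul_left
    (Real.sin u * oddSech π 0)
  have hb (n : ℕ) : |2 * (2 * ((n + 1 : ℕ) : ℝ) + 1) * oddSech π (n + 1 : ℕ) *
      Real.sin ((2 * (n + 1 : ℕ) + 1) * u)| ≤ Real.sin u * oddSech π 0 * (3 / 20) ^ n := by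
    have h1 := abs_sin_nat_mul_le (2 * n + 3) u
    have h2 := oddSech_pi_succ_le n
    have h3 := oddSech_pos π (n + 1 : ℕ)
    have e : (2 * ((n + 1 : ℕ) : ℝ) + 1) = (2 * n + 3 : ℕ) := by push_cast; ring
    rw [e, abs_mul, abs_of_nonneg (by positivity)]
    rw [abs_of_pos hu] at h1
    calc _ ≤ 2 * ((2 * n + 3 : ℕ) : ℝ) * oddSech π (n + 1 : ℕ) *
          (((2 * n + 3 : ℕ) : ℝ) * Real.sin u) := by gcongr
      _ = 2 * Real.sin u * ((2 * (n : ℝ) + 3) ^ 2 * oddSech π (n + 1 : ℕ)) := by push_cast; ring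
      _ ≤ 2 * Real.sin u * (1 / 2 * oddSech π 0 * (3 / 20) ^ n) := by gcongr
      _ = _ := by ring
  have ht := tsum_of_norm_bounded (f := fun n : ℕ => 2 * (2 * ((n + 1 : ℕ) : ℝ) + 1) *
    oddSech π (n + 1 : ℕ) * Real.sin ((2 * (n + 1 : ℕ) + 1) * u)) hg hb
  rw [hs.tsum_eq_zero_add]
  have := (abs_le.1 ((Real.norm_eq_abs _).symm.trans_le ht)).1
  norm_num at this ⊢
  nlinarith [mul_pos hu h0]

/-- The quarter period of the solution of `f'' = -2 f ^ 3`, as a beta integral. -/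
theorem setIntegral_eq_of_ode {f g : ℝ → ℝ} {b s : ℝ} (hb : 0 < b) (hs : 0 < s)
    (hf : ∀ u, HasDerivAt f (g u) u) (hg : ∀ u, HasDerivAt g (-2 * f u ^ 3) u)
    (hneg : ∀ u ∈ Set.Ioo 0 b, g u < 0) (g0 : g 0 = 0) (fb : f b = 0) (gb : g b = -s ^ 2) :
    ∫ t in Set.Ioo (0 : ℝ) 1, t ^ (1 / 4 - 1 : ℝ) * (1 - t) ^ (1 / 2 - 1 : ℝ) = 4 * s * b := by
  have energy (u : ℝ) : g u ^ 2 + f u ^ 4 = s ^ 4 := by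
    have hd (v : ℝ) : HasDerivAt (fun v => g v ^ 2 + f v ^ 4) 0 v := by
      refine (((hg v).fun_pow 2).fun_add ((hf v).fun_pow 4)).congr_deriv ?_
      push_cast
      ring
    have := is_const_of_deriv_eq_zero (fun v => (hd v).differentiableAt) (fun v => (hd v).deriv) u b
    rw [this, fb, gb]
    ring
  have hcont : Continuous f := continuous_iff_continuousAt.2 fun u => (hf u).continuousAt
  have hanti : StrictAntiOn f (Set.Icc 0 b) := by
    refine strictAntiOn_of_deriv_neg (convex_Icc 0 b) hcont.continuousOn fun u hu => ?_
    rw [interior_Icc] at hu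
    rw [(hf u).deriv]
    exact hneg u hu
  have h0 : (0 : ℝ) ∈ Set.Icc 0 b := ⟨le_rfl, hb.le⟩
  have hbm : b ∈ Set.Icc 0 b := ⟨hb.le, le_rfl⟩
  have f0 : f 0 = s := by
    have h1 : 0 < f 0 := by simpa [fb] using hanti h0 hbm hb
    have h2 := energy 0
    rw [g0] at h2
    exact (pow_left_inj₀ h1.le hs.le (by norm_num : (4 : ℕ) ≠ 0)).1 (by linarith)
  have fpos (u : ℝ) (hu : u ∈ Set.Ioo 0 b) : 0 < f u := by
    simpa [fb] using hanti ⟨hu.1.le, hu.2.le⟩ hbm hu.2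
  set T : ℝ → ℝ := fun u => (f u / s) ^ 4 with hT
  have hTd (u : ℝ) : HasDerivAt T (4 * (f u / s) ^ 3 * (g u / s)) u := by
    refine (((hf u).div_const s).fun_pow 4).congr_deriv ?_
    norm_num
  have hTc : ContinuousOn T (Set.Icc 0 b) := fun u _ => (hTd u).continuousAt.continuousWithinAt
  have hTanti : StrictAntiOn T (Set.Icc 0 b) := by
    intro u hu v hv huv
    have h1 := hanti hu hv huv
    have h2 : 0 ≤ f v := by simpa [fb] using hanti.antitoneOn hv hbm hv.2
    simp only [hT]
    gcongr
  have T0 : T 0 = 1 := by simp [hT, f0, hs.ne']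
  have Tb : T b = 0 := by simp [hT, fb]
  have himage : T '' Set.Ioo 0 b = Set.Ioo 0 1 := by
    apply Set.Subset.antisymm
    · rintro _ ⟨u, hu, rfl⟩
      have hu' : u ∈ Set.Icc 0 b := ⟨hu.1.le, hu.2.le⟩
      exact ⟨Tb ▸ hTanti hu' hbm hu.2, T0 ▸ hTanti h0 hu' hu.1⟩
    · have := intermediate_value_Ioo' hb.le hTc
      rwa [T0, Tb] at this
  have hinj : Set.InjOn T (Set.Ioo 0 b) := hTanti.injOn.mono Set.Ioo_subset_Icc_self
  rw [← himage, MeasureTheory.integral_image_eq_integral_abs_deriv_smul measurableSet_Ioo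
    (fun u _ => (hTd u).hasDerivWithinAt) hinj]
  have hint : ∀ u ∈ Set.Ioo 0 b, |4 * (f u / s) ^ 3 * (g u / s)| •
      (T u ^ (1 / 4 - 1 : ℝ) * (1 - T u) ^ (1 / 2 - 1 : ℝ)) = 4 * s := by
    intro u hu
    have hfu := fpos u hu
    have hgu := hneg u hu
    have hx : 0 < f u / s := by positivity
    have hy : 0 < -g u / s ^ 2 := div_pos (by linarith) (by positivity)
    have e1 : T u ^ (1 / 4 - 1 : ℝ) = ((f u / s) ^ 3)⁻¹ := by
      simp only [hT]
      rw [← Real.rpow_natCast, ← Real.rpow_mul hx.le, ← Real.rpow_natCast, ← Real.rpow_neg hx.le]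
      norm_num
    have e2 : 1 - T u = (-g u / s ^ 2) ^ 2 := by
      have := energy u
      simp only [hT]
      field_simp
      linarith
    have e3 : (1 - T u) ^ (1 / 2 - 1 : ℝ) = (-g u / s ^ 2)⁻¹ := by
      rw [e2, ← Real.rpow_natCast, ← Real.rpow_mul hy.le, ← Real.rpow_neg_one]
      norm_num
    have e4 : |4 * (f u / s) ^ 3 * (g u / s)| = 4 * (f u / s) ^ 3 * (-g u / s) := by
      rw [abs_of_nonpos]
      · ring
      · exact mul_nonpos_of_nonneg_of_nonpos (by positivity)
          (div_nonpos_of_nonpos_of_nonneg hgu.le hs.le)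
    rw [e1, e3, e4, smul_eq_mul]
    have := hgu.ne
    field_simp
  rw [MeasureTheory.setIntegral_congr_fun measurableSet_Ioo hint]
  simp [hb.le]
  ring

theorem setIntegral_beta (α β : ℝ) (hα : 0 < α) (hβ : 0 < β) :
    ∫ t in Set.Ioo (0 : ℝ) 1, t ^ (α - 1) * (1 - t) ^ (β - 1) =
      Real.Gamma α * Real.Gamma β / Real.Gamma (α + β) := by
  have h := ProbabilityTheory.beta_eq_betaIntegralReal α β hα hβ
  rw [ProbabilityTheory.beta] at h
  rw [h, Complex.betaIntegral, intervalIntegral.integral_of_le zero_le_one,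
    MeasureTheory.integral_Ioc_eq_integral_Ioo]
  have e : ∀ t ∈ Set.Ioo (0 : ℝ) 1, (t : ℂ) ^ ((α : ℂ) - 1) * (1 - (t : ℂ)) ^ ((β : ℂ) - 1) =
      ((t ^ (α - 1) * (1 - t) ^ (β - 1) : ℝ) : ℂ) := by
    intro t ht
    push_cast
    rw [Complex.ofReal_cpow ht.1.le, Complex.ofReal_cpow (by linarith [ht.2])]
    push_cast
    rfl
  rw [MeasureTheory.setIntegral_congr_fun measurableSet_Ioo e, integral_complex_ofReal,
    Complex.ofReal_re]

theorem setIntegral_beta_quarter_half :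
    ∫ t in Set.Ioo (0 : ℝ) 1, t ^ (1 / 4 - 1 : ℝ) * (1 - t) ^ (1 / 2 - 1 : ℝ) =
      Real.Gamma (1 / 4) ^ 2 / √(2 * π) := by
  rw [setIntegral_beta _ _ (by norm_num) (by norm_num), Real.Gamma_one_half_eq]
  have hpi := Real.pi_pos
  have hr := Real.Gamma_mul_Gamma_one_sub (1 / 4)
  rw [show π * (1 / 4) = π / 4 by ring, Real.sin_pi_div_four] at hr
  have h34 : Real.Gamma (1 / 4 + 1 / 2) = Real.Gamma (1 - 1 / 4) := by norm_num
  have hp : 0 < Real.Gamma (1 - 1 / 4) := Real.Gamma_pos_of_pos (by norm_num)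
  have h2 : (√2) ^ 2 = 2 := Real.sq_sqrt (by norm_num)
  have h3 : (√π) ^ 2 = π := Real.sq_sqrt hpi.le
  rw [h34, Real.sqrt_mul (by norm_num), div_eq_div_iff hp.ne' (by positivity)]
  have h4 : Real.Gamma (1 / 4) * Real.Gamma (1 - 1 / 4) = √2 * π := by
    rw [hr]
    field_simp
    linarith
  linear_combination (Real.Gamma (1 / 4) * √2) * h3 - Real.Gamma (1 / 4) * h4

theorem re_sechSeries_one_neg {u : ℝ} (hu : 0 < Real.sin u) : (sechSeries π 1 u).re < 0 := by
  rw [sechSeries, trigSeries_one_of_even (rapidDecay_oddSech Real.pi_pos) (oddSech_neg π),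
    Complex.ofReal_re]
  exact neg_neg_of_pos (tsum_oddSech_pi_sin_pos hu)

theorem re_sechSeries_one_pi_div_two :
    (sechSeries π 1 (π / 2)).re = -2 * altOddSum (oddSech π) 1 := by
  have h := trigSeries_odd_pi_div_two (rapidDecay_oddSech Real.pi_pos) (oddSech_neg π) 0
  rw [sechSeries, h]
  simp

theorem altOddSum_oddSech_pi_one_pos : 0 < altOddSum (oddSech π) 1 := by
  have h := re_sechSeries_one_neg (u := π / 2) (by simp)
  rw [re_sechSeries_one_pi_div_two] at h
  linarith

theorem altOddSum_oddSech_pi_three : altOddSum (oddSech π) 3 = 0 := by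
  have h := altOddSum_oddSech_functional (k := 3) (by norm_num) Complex.I_pow_four (by decide)
    Real.pi_pos
  rw [sq, mul_div_assoc, div_self Real.pi_ne_zero, mul_one, one_pow] at h
  linarith

theorem altOddSum_oddSech_pi_one :
    altOddSum (oddSech π) 1 = Real.Gamma (1 / 4) ^ 4 / (16 * π ^ 3) := by
  have hpi := Real.pi_pos
  have hs := rapidDecay_oddSech hpi
  have h1 := altOddSum_oddSech_pi_one_pos
  have hD (k : ℕ) (u : ℝ) :
      HasDerivAt (fun u => (sechSeries π k u).re) (sechSeries π (k + 1) u).re u :=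
    Complex.reCLM.hasFDerivAt.comp_hasDerivAt u (hs.hasDerivAt_trigSeries 1 k u)
  have hode (u : ℝ) : (sechSeries π 2 u).re = -2 * (sechSeries π 0 u).re ^ 3 := by
    rw [sechSeries_two hpi h1.ne' altOddSum_oddSech_pi_three]
    have h : sechSeries π 0 u = _ := trigSeries_zero_of_even hs (oddSech_neg π) u
    rw [h]
    norm_cast
  have hsq := Real.sq_sqrt (by positivity : 0 ≤ 2 * altOddSum (oddSech π) 1)
  have h := setIntegral_eq_of_ode (b := π / 2) (s := √(2 * altOddSum (oddSech π) 1))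
    (by positivity) (by positivity) (hD 0) (fun u => (hD 1 u).congr_deriv (hode u))
    (fun u hu => re_sechSeries_one_neg
      (Real.sin_pos_of_pos_of_lt_pi hu.1 (by linarith [hu.2])))
    (by
      rw [sechSeries, trigSeries_one_of_even hs (oddSech_neg π)]
      simp)
    (by
      have h := trigSeries_zero_pi_div_two hs (oddSech_neg π)
      rw [sechSeries, h, Complex.zero_re])
    (by
      rw [hsq]
      exact re_sechSeries_one_pi_div_two.trans (by ring))
  rw [setIntegral_beta_quarter_half] at h
  have h2 := congrArg (· ^ 2) h
  simp only [div_pow, mul_pow, hsq] at h2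
  rw [Real.sq_sqrt (by positivity)] at h2
  field_simp at h2 ⊢
  linarith

theorem sum_odd_ninth_cosh_cubed :
    (∑' n : ℕ, (-1 : ℝ) ^ n * (2*(n:ℝ)+1) ^ 9 / Real.cosh ((2*(n:ℝ)+1) * π / 2) ^ 3) =
      189 * Real.Gamma (1/4) ^ 20 / (2 ^ 13 * π ^ 15)
    - 297 * Real.Gamma (1/4) ^ 20 / (2 ^ 12 * π ^ 16) := by
  have hpi := Real.pi_pos
  have e : (∑' n : ℕ, (-1 : ℝ) ^ n * (2*(n:ℝ)+1) ^ 9 / Real.cosh ((2*(n:ℝ)+1) * π / 2) ^ 3) =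
      altOddSum (fun n => oddSech π n ^ 3) 9 := by
    refine tsum_congr fun n => ?_
    simp [oddSech, div_eq_mul_inv]
  obtain ⟨h9, h8⟩ := altOddSum_oddSech_nine hpi altOddSum_oddSech_pi_one_pos.ne'
    altOddSum_oddSech_pi_three
  rw [e, altOddSum_oddSech_cubed_pi, h9, h8, altOddSum_oddSech_pi_one]
  field_simp
  ring
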